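/- Assume the continuum hypothesis (2^{ℵ₀} = ℵ₁). Then every infinite-dimensional factor N acting on a separable Hilbert space admits 2^{ℵ₁} distinct classically normal, singular pure states. -/

import Mathlib

open scoped ComplexOrder InnerProductSpace
open Filter Topology

noncomputable instance {H : Type*} [NormedAddCommGroup H] [InnerProductSpace ℂ H]
    [CompleteSpace H] : SMulMemClass (VonNeumannAlgebra H) ℂ (H →L[ℂ] H) :=
  ⟨fun {s} c {_} hx => s.toStarSubalgebra.smul_mem hx c⟩

/-- The σ-weak (ultraweak, weak*) topology on `B(H)`: the initial topology induced by the
functionals `x ↦ ∑' n, ⟪ξ n, x (η n)⟫` over all pairs of square-summable sequences. -/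
noncomputable def sigmaWeak (H : Type*) [NormedAddCommGroup H] [InnerProductSpace ℂ H]
    [CompleteSpace H] : TopologicalSpace (H →L[ℂ] H) :=
  ⨅ (ξ : ℕ → H) (η : ℕ → H) (_ : Summable fun n => ‖ξ n‖ ^ 2)
    (_ : Summable fun n => ‖η n‖ ^ 2),
    TopologicalSpace.induced (fun x : H →L[ℂ] H => ∑' n, ⟪ξ n, x (η n)⟫_ℂ) inferInstance

variable {H : Type*} [NormedAddCommGroup H] [InnerProductSpace ℂ H] [CompleteSpace H]

/-- A positive linear functional on a von Neumann algebra. -/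
def IsPosFunctional (M : VonNeumannAlgebra H) (f : ↥M →ₗ[ℂ] ℂ) : Prop :=
  ∀ a : ↥M, 0 ≤ f (star a * a)

/-- A state on a von Neumann algebra: a positive linear functional sending `1` to `1`. -/
def IsStateOn (M : VonNeumannAlgebra H) (f : ↥M →ₗ[ℂ] ℂ) : Prop :=
  IsPosFunctional M f ∧ f 1 = 1

/-- A pure state: a state such that every positive linear functional it dominates is a
nonnegative scalar multiple of it. -/
def IsPureStateOn (M : VonNeumannAlgebra H) (f : ↥M →ₗ[ℂ] ℂ) : Prop :=
  IsStateOn M f ∧ ∀ g : ↥M →ₗ[ℂ] ℂ, IsPosFunctional M g → IsPosFunctional M (f - g) →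
    ∃ t : ℝ, 0 ≤ t ∧ g = (t : ℂ) • f

/-- A functional on a von Neumann algebra is normal if it is continuous for the σ-weak
topology. -/
def IsNormalOn (M : VonNeumannAlgebra H) (f : ↥M →ₗ[ℂ] ℂ) : Prop :=
  @Continuous ↥M ℂ
    (TopologicalSpace.induced (fun x : ↥M => (x : H →L[ℂ] H)) (sigmaWeak H)) _ f

/-- A state on a von Neumann algebra is singular if the only normal positive linear
functional it dominates is `0`. -/
def IsSingularOn (M : VonNeumannAlgebra H) (f : ↥M →ₗ[ℂ] ℂ) : Prop :=
  ∀ g : ↥M →ₗ[ℂ] ℂ, IsPosFunctional M g → IsPosFunctional M (f - g) → IsNormalOn M g → g = 0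

/-- A projection: a self-adjoint idempotent. -/
def IsProjection (p : H →L[ℂ] H) : Prop := star p = p ∧ p * p = p

/-- `q` is a subprojection of `p` (i.e. `q ≤ p` for projections). -/
def ProjLE (q p : H →L[ℂ] H) : Prop := q * p = q ∧ p * q = q

/-- `p` is a minimal projection of the set `S`: a nonzero projection in `S` such that the
only projections of `S` below `p` are `0` and `p`. -/
def IsMinimalProjectionIn (S : Set (H →L[ℂ] H)) (p : H →L[ℂ] H) : Prop :=
  p ∈ S ∧ IsProjection p ∧ p ≠ 0 ∧
    ∀ q ∈ S, IsProjection q → ProjLE q p → q = 0 ∨ q = p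

/-- `f` is multiplicative on the subset `C` of `M`. -/
def IsMultiplicativeOn (M : VonNeumannAlgebra H) (f : ↥M →ₗ[ℂ] ℂ)
    (C : Set (H →L[ℂ] H)) : Prop :=
  ∀ a b : ↥M, (a : H →L[ℂ] H) ∈ C → (b : H →L[ℂ] H) ∈ C → f (a * b) = f a * f b

/-- `f` is normal on the von Neumann subalgebra `C` of `M` (where `C ⊆ M`): the restriction
of `f` to `C` is σ-weakly continuous. -/
def IsNormalOnSub (M : VonNeumannAlgebra H) (f : ↥M →ₗ[ℂ] ℂ) (C : VonNeumannAlgebra H)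
    (hC : (C : Set (H →L[ℂ] H)) ⊆ M) : Prop :=
  @Continuous ↥C ℂ
    (TopologicalSpace.induced (fun x : ↥C => (x : H →L[ℂ] H)) (sigmaWeak H)) _
    (fun x => f ⟨x, hC x.2⟩)

/-- A state on `M` is classically normal if it is normal on every von Neumann subalgebra
of `M` (with the same unit) on which it is multiplicative. -/
def IsClassicallyNormalOn (M : VonNeumannAlgebra H) (f : ↥M →ₗ[ℂ] ℂ) : Prop :=
  ∀ (C : VonNeumannAlgebra H) (hC : (C : Set (H →L[ℂ] H)) ⊆ M),
    IsMultiplicativeOn M f (C : Set (H →L[ℂ] H)) → IsNormalOnSub M f C hC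

/-- A von Neumann algebra is a factor if its center consists of the scalar multiples of
the identity. -/
def IsFactor (N : VonNeumannAlgebra H) : Prop :=
  ∀ x ∈ N, (∀ y ∈ N, x * y = y * x) → ∃ c : ℂ, x = c • (1 : H →L[ℂ] H)

/-- A positive operator on a Hilbert space. -/
def IsPositiveOp (a : H →L[ℂ] H) : Prop :=
  star a = a ∧ ∀ v : H, 0 ≤ ⟪v, a v⟫_ℂ

/-- The projection onto the closed linear span of the ranges of a family of operators. -/
noncomputable def rangeSup {ι : Type*} (u : ι → H →L[ℂ] H) : H →L[ℂ] H :=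
  (⨆ i, (u i).range).topologicalClosure.starProjection

theorem isStarProjection_rangeSup {ι : Type*} (u : ι → H →L[ℂ] H) :
    IsStarProjection (rangeSup u) :=
  isStarProjection_starProjection

theorem rangeSup_mul {ι : Type*} (u : ι → H →L[ℂ] H) (i : ι) : rangeSup u * u i = u i := by
  ext ξ
  exact Submodule.starProjection_eq_self_iff.2
    (Submodule.le_topologicalClosure _ (Submodule.mem_iSup_of_mem i ⟨ξ, rfl⟩))

theorem mul_rangeSup_eq_zero {ι : Type*} {u : ι → H →L[ℂ] H} {t : H →L[ℂ] H}
    (h : ∀ i, t * u i = 0) : t * rangeSup u = 0 := by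
  ext ξ
  have hle : (⨆ i, (u i).range).topologicalClosure ≤ t.ker := by
    refine Submodule.topologicalClosure_minimal _ (iSup_le fun i => ?_) t.isClosed_ker
    rintro _ ⟨ζ, rfl⟩
    exact DFunLike.congr_fun (h i) ζ
  exact hle (Submodule.starProjection_apply_mem _ ξ)

theorem VonNeumannAlgebra.mem_of_forall_commute {N : VonNeumannAlgebra H} {x : H →L[ℂ] H}
    (h : ∀ y ∈ N.commutant, Commute x y) : x ∈ N := by
  rw [← N.commutant_commutant, VonNeumannAlgebra.mem_commutant_iff]
  exact fun y hy => (h y hy).symm.eq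

theorem VonNeumannAlgebra.commute_of_mem_commutant {N : VonNeumannAlgebra H} {x y : H →L[ℂ] H}
    (hx : x ∈ N) (hy : y ∈ N.commutant) : Commute x y :=
  VonNeumannAlgebra.mem_commutant_iff.1 hy x hx

theorem IsStarProjection.commute_of_mul_eq {R y : H →L[ℂ] H} (hR : IsStarProjection R)
    (h₁ : R * (y * R) = y * R) (h₂ : R * (star y * R) = star y * R) : Commute R y := by
  have h := congrArg star h₂
  simp only [star_mul, star_star, hR.isSelfAdjoint.star_eq] at h
  rw [commute_iff_eq, ← h₁, ← h, mul_assoc]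

theorem rangeSup_commute {ι : Type*} {u : ι → H →L[ℂ] H} {y : H →L[ℂ] H}
    (h₁ : ∀ i, rangeSup u * (y * u i) = y * u i)
    (h₂ : ∀ i, rangeSup u * (star y * u i) = star y * u i) : Commute (rangeSup u) y := by
  have key : ∀ z : H →L[ℂ] H, (∀ i, rangeSup u * (z * u i) = z * u i) →
      rangeSup u * (z * rangeSup u) = z * rangeSup u := by
    intro z hz
    have : (rangeSup u * z - z) * rangeSup u = 0 :=
      mul_rangeSup_eq_zero fun i => by rw [sub_mul, mul_assoc, hz i, sub_self]
    rwa [sub_mul, mul_assoc, sub_eq_zero] at this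
  exact (isStarProjection_rangeSup u).commute_of_mul_eq (key _ h₁) (key _ h₂)

theorem rangeSup_mem {ι : Type*} {N : VonNeumannAlgebra H} {u : ι → H →L[ℂ] H}
    (hu : ∀ i, u i ∈ N) : rangeSup u ∈ N := by
  have key : ∀ y ∈ N.commutant, ∀ i, rangeSup u * (y * u i) = y * u i := fun y hy i => by
    rw [← (N.commute_of_mem_commutant (hu i) hy).eq, ← mul_assoc, rangeSup_mul]
  exact N.mem_of_forall_commute fun y hy => rangeSup_commute (key y hy) (key _ (star_mem hy))

theorem posPart_mem {N : VonNeumannAlgebra H} {x : H →L[ℂ] H} (hx : x ∈ N) : x⁺ ∈ N :=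
  N.mem_of_forall_commute fun _ hy => (N.commute_of_mem_commutant hx hy).cfcₙ_real _

theorem sqrt_mem {N : VonNeumannAlgebra H} {x : H →L[ℂ] H} (hx : x ∈ N) : CFC.sqrt x ∈ N :=
  N.mem_of_forall_commute fun _ hy => (N.commute_of_mem_commutant hx hy).cfcₙ_nnreal _

theorem posPart_mul_self {x : H →L[ℂ] H} (hx : IsSelfAdjoint x) : x⁺ * x = x⁺ * x⁺ := by
  conv_lhs => rw [← CFC.posPart_sub_negPart x hx, mul_sub, CFC.posPart_sub_negPart x hx]
  simp

theorem eq_zero_of_star_mul_self {x : H →L[ℂ] H} (h : star x * x = 0) : x = 0 :=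
  CStarRing.star_mul_self_eq_zero_iff x |>.1 h

theorem re_inner_le_of_le {x y : H →L[ℂ] H} (h : x ≤ y) (ξ : H) :
    (⟪ξ, x ξ⟫_ℂ).re ≤ (⟪ξ, y ξ⟫_ℂ).re := by
  have := ((ContinuousLinearMap.le_def x y).1 h).re_inner_nonneg_right ξ
  simpa [inner_sub_right] using this

theorem le_of_forall_re_inner_le {x y : H →L[ℂ] H} (hx : IsSelfAdjoint x) (hy : IsSelfAdjoint y)
    (h : ∀ ξ, (⟪ξ, x ξ⟫_ℂ).re ≤ (⟪ξ, y ξ⟫_ℂ).re) : x ≤ y := by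
  rw [ContinuousLinearMap.le_def, ContinuousLinearMap.isPositive_def']
  refine ⟨hy.sub hx, fun ξ => ?_⟩
  rw [ContinuousLinearMap.reApplyInnerSelf_apply, inner_re_symm]
  simpa [inner_sub_right] using h ξ

/-- In a factor, two nonzero elements are never separated by the whole algebra. -/
theorem IsFactor.exists_mul_mul_ne_zero {N : VonNeumannAlgebra H} (hN : IsFactor N)
    {s t : H →L[ℂ] H} (ht : t ∈ N) (hs0 : s ≠ 0) (ht0 : t ≠ 0) :
    ∃ z ∈ N, s * z * t ≠ 0 := by
  by_contra! hcon
  set u : N → H →L[ℂ] H := fun z => (z : H →L[ℂ] H) * t with hu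
  have hmem : rangeSup u ∈ N := rangeSup_mem fun z => mul_mem z.2 ht
  have key : ∀ y ∈ N, ∀ i, rangeSup u * (y * u i) = y * u i := fun y hy i => by
    have := rangeSup_mul u (⟨y, hy⟩ * i)
    simpa [hu, mul_assoc] using this
  obtain ⟨c, hc⟩ := hN _ hmem fun y hy => (rangeSup_commute (key y hy) (key _ (star_mem hy))).eq
  have h1 : rangeSup u * t = t := by simpa [hu] using rangeSup_mul u 1
  have h2 : s * rangeSup u = 0 := mul_rangeSup_eq_zero fun z => by
    rw [← mul_assoc]; exact hcon z z.2
  rw [hc] at h1 h2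
  have hc0 : c = 0 := by simpa [hs0] using h2
  exact ht0 (by rw [← h1, hc0]; simp)

theorem posPart_mul_eq_self {d e : H →L[ℂ] H} (hd : IsSelfAdjoint d) (he : IsStarProjection e)
    (hde : d * e = d) : d⁺ * e = d⁺ := by
  have hu : star d⁺ = d⁺ := (IsSelfAdjoint.of_nonneg (CFC.posPart_nonneg d)).star_eq
  have h : d⁺ - d⁺ * e = 0 := by
    refine eq_zero_of_star_mul_self ?_
    have h1 : d⁺ * (d⁺ - d⁺ * e) = 0 := by
      rw [mul_sub, ← mul_assoc, ← posPart_mul_self hd, mul_assoc, hde, sub_self]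
    rw [star_sub, star_mul, hu, he.isSelfAdjoint.star_eq, sub_mul, mul_assoc, h1]
    simp
  exact (sub_eq_zero.1 h).symm

/-- A minimal projection of a von Neumann algebra cuts it down to the scalars. -/
theorem exists_corner_eq_smul {N : VonNeumannAlgebra H} {e : H →L[ℂ] H} (he : IsStarProjection e)
    (heN : e ∈ N) (hmin : ∀ q ∈ N, IsStarProjection q → e * q = q → q = 0 ∨ q = e)
    {x : H →L[ℂ] H} (hx : x ∈ N) : ∃ c : ℂ, e * x * e = c • e := by
  have hee := he.isIdempotentElem.eq
  have hes := he.isSelfAdjoint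
  by_cases he0 : e = 0
  · exact ⟨0, by simp [he0]⟩
  obtain ⟨ξ, hξ0, hξe⟩ : ∃ ξ : H, ξ ≠ 0 ∧ e ξ = ξ := by
    by_contra! hcon
    refine he0 (ContinuousLinearMap.ext fun ζ => ?_)
    by_contra h
    exact hcon (e ζ) h (DFunLike.congr_fun hee ζ)
  have main : ∀ d ∈ N, IsSelfAdjoint d → d * e = d → ∃ c : ℂ, d = c • e := by
    intro d hdN hd hde
    have dich : ∀ l : ℝ, d ≤ (l : ℂ) • e ∨ (l : ℂ) • e ≤ d := by
      intro l
      have hg : IsSelfAdjoint (d - (l : ℂ) • e) :=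
        hd.sub (IsSelfAdjoint.smul (Complex.conj_ofReal l) hes)
      set g := d - (l : ℂ) • e with hgdef
      have hgN : g ∈ N := sub_mem hdN (SMulMemClass.smul_mem _ heN)
      have hge : g * e = g := by rw [hgdef, sub_mul, hde, smul_mul_assoc, hee]
      have hpe : g⁺ * e = g⁺ := posPart_mul_eq_self hg he hge
      have hne : g⁻ * e = g⁻ := by
        rw [← CFC.posPart_neg]
        exact posPart_mul_eq_self hg.neg he (by rw [neg_mul, hge])
      have hep : e * g⁺ = g⁺ := by
        have := congrArg star hpe
        rwa [star_mul, hes.star_eq,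
          (IsSelfAdjoint.of_nonneg (CFC.posPart_nonneg g)).star_eq] at this
      set R := rangeSup (fun _ : Unit => g⁺) with hR
      have hRg : R * g⁺ = g⁺ := rangeSup_mul (fun _ : Unit => g⁺) ()
      have heR : e * R = R := by
        have : (1 - e) * R = 0 := mul_rangeSup_eq_zero fun _ => by
          rw [sub_mul, one_mul, hep, sub_self]
        rw [sub_mul, one_mul, sub_eq_zero] at this
        exact this.symm
      have hnR : g⁻ * R = 0 := mul_rangeSup_eq_zero fun _ => CFC.negPart_mul_posPart g
      rcases hmin R (rangeSup_mem fun _ => posPart_mem hgN) (isStarProjection_rangeSup _) heR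
        with h0 | h1
      · left
        have : g⁺ = 0 := by rw [← hRg, h0, zero_mul]
        exact sub_nonpos.1 ((CFC.posPart_eq_zero_iff g hg).1 this)
      · right
        have : g⁻ = 0 := by rw [← hne, ← h1, hnR]
        exact sub_nonneg.1 ((CFC.negPart_eq_zero_iff g hg).1 this)
    have hre : ∀ (l : ℝ) (ζ : H),
        (⟪ζ, ((l : ℂ) • e) ζ⟫_ℂ).re = l * (⟪ζ, e ζ⟫_ℂ).re := by
      intro l ζ
      simp
    have hξpos : 0 < (⟪ξ, e ξ⟫_ℂ).re := by
      rw [hξe]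
      have := inner_self_eq_norm_sq (𝕜 := ℂ) ξ
      simp only [RCLike.re_eq_complex_re] at this
      rw [this]
      positivity
    set c : ℝ := (⟪ξ, d ξ⟫_ℂ).re / (⟪ξ, e ξ⟫_ℂ).re with hc
    have up : ∀ l : ℝ, c < l → d ≤ (l : ℂ) • e := by
      intro l hl
      refine (dich l).resolve_right fun h => ?_
      have := re_inner_le_of_le h ξ
      rw [hre, ← le_div_iff₀ hξpos] at this
      exact absurd this (not_le.2 hl)
    have down : ∀ l : ℝ, l < c → (l : ℂ) • e ≤ d := by
      intro l hl
      refine (dich l).resolve_left fun h => ?_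
      have := re_inner_le_of_le h ξ
      rw [hre, ← div_le_iff₀ hξpos] at this
      exact absurd this (not_le.2 hl)
    have hcs : IsSelfAdjoint ((c : ℂ) • e) := IsSelfAdjoint.smul (Complex.conj_ofReal c) hes
    have hcont : ∀ ζ : H, Continuous fun l : ℝ => l * (⟪ζ, e ζ⟫_ℂ).re :=
      fun ζ => continuous_id.mul continuous_const
    refine ⟨c, le_antisymm (le_of_forall_re_inner_le hd hcs fun ζ => ?_)
      (le_of_forall_re_inner_le hcs hd fun ζ => ?_)⟩
    · rw [hre]
      refine ge_of_tendsto ((hcont ζ).tendsto c |>.mono_left (nhdsWithin_le_nhds (s := Set.Ioi c))) ?_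
      filter_upwards [self_mem_nhdsWithin] with l hl
      rw [← hre]
      exact re_inner_le_of_le (up l hl) ζ
    · rw [hre]
      refine le_of_tendsto ((hcont ζ).tendsto c |>.mono_left (nhdsWithin_le_nhds (s := Set.Iio c))) ?_
      filter_upwards [self_mem_nhdsWithin] with l hl
      rw [← hre]
      exact re_inner_le_of_le (down l hl) ζ
  have corner : ∀ y ∈ N, IsSelfAdjoint y → ∃ c : ℂ, e * y * e = c • e := fun y hyN hy =>
    main _ (mul_mem (mul_mem heN hyN) heN)
      (by simpa [hes.star_eq] using hy.conjugate e) (by rw [mul_assoc, hee])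
  obtain ⟨c₁, h₁⟩ := corner (x + star x) (add_mem hx (star_mem hx)) (IsSelfAdjoint.add_star_self x)
  obtain ⟨c₂, h₂⟩ := corner (Complex.I • (x - star x))
    (SMulMemClass.smul_mem _ (sub_mem hx (star_mem hx))) (by
      rw [IsSelfAdjoint, star_smul, star_sub, star_star]
      simp only [RCLike.star_def, Complex.conj_I]
      module)
  refine ⟨(1 / 2) * c₁ - (1 / 2) * Complex.I * c₂, ?_⟩
  have hsplit : x = (1 / 2 : ℂ) • (x + star x)
      - ((1 / 2 : ℂ) * Complex.I) • (Complex.I • (x - star x)) := by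
    rw [smul_smul, mul_assoc, Complex.I_mul_I]
    module
  conv_lhs => rw [hsplit]
  rw [mul_sub, sub_mul, mul_smul_comm, smul_mul_assoc, h₁, mul_smul_comm, smul_mul_assoc, h₂]
  module

/-- `p` is a minimal projection of `N`. -/
def IsMinimalStarProjection (N : VonNeumannAlgebra H) (e : H →L[ℂ] H) : Prop :=
  IsStarProjection e ∧ e ∈ N ∧ ∀ q ∈ N, IsStarProjection q → e * q = q → q = 0 ∨ q = e

theorem IsMinimalStarProjection.exists_mul_mul_mem_span {N : VonNeumannAlgebra H}
    {e e' : H →L[ℂ] H} (he : IsMinimalStarProjection N e) (he' : IsMinimalStarProjection N e') :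
    ∃ x₀ : H →L[ℂ] H, ∀ x ∈ N, e * x * e' ∈ Submodule.span ℂ {x₀} := by
  by_cases h : ∀ x ∈ N, e * x * e' = 0
  · exact ⟨0, fun x hx => by simp [h x hx]⟩
  push Not at h
  obtain ⟨z, hz, hz0⟩ := h
  refine ⟨e * z * e', fun x hx => ?_⟩
  have hes := he.1.isSelfAdjoint.star_eq
  have hes' := he'.1.isSelfAdjoint.star_eq
  have hee := he.1.isIdempotentElem.eq
  have hee' := he'.1.isIdempotentElem.eq
  obtain ⟨c, hc⟩ := exists_corner_eq_smul he.1 he.2.1 he.2.2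
    (mul_mem (mul_mem hx he'.2.1) (star_mem hz))
  obtain ⟨d, hd⟩ := exists_corner_eq_smul he'.1 he'.2.1 he'.2.2
    (mul_mem (mul_mem (star_mem hz) he.2.1) hz)
  have hd0 : d ≠ 0 := by
    rintro rfl
    refine hz0 (eq_zero_of_star_mul_self ?_)
    rw [zero_smul] at hd
    rw [← hd]
    simp only [star_mul, hes, hes']
    calc e' * (star z * e) * (e * z * e') = e' * star z * (e * e) * z * e' := by noncomm_ring
      _ = _ := by rw [hee]; noncomm_ring
  have hkey : d • (e * x * e') = c • (e * z * e') := by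
    calc d • (e * x * e') = e * x * (d • e') := by rw [mul_smul_comm]
      _ = (e * (x * e' * star z) * e) * (z * e') := by rw [← hd]; noncomm_ring
      _ = c • (e * z * e') := by rw [hc, smul_mul_assoc, mul_assoc]
  rw [Submodule.mem_span_singleton]
  exact ⟨d⁻¹ * c, by rw [mul_smul, ← hkey, smul_smul, inv_mul_cancel₀ hd0, one_smul]⟩

theorem exists_list_sum_eq_of_wellFounded {N : VonNeumannAlgebra H}
    (hwf : WellFounded fun q p : {p : H →L[ℂ] H // p ∈ N ∧ IsStarProjection p} =>
      (p : H →L[ℂ] H) * q = q ∧ q ≠ p)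
    (p : {p : H →L[ℂ] H // p ∈ N ∧ IsStarProjection p}) :
    ∃ l : List (H →L[ℂ] H), (∀ e ∈ l, IsMinimalStarProjection N e) ∧ l.sum = p := by
  induction p using hwf.induction with
  | _ p ih =>
  by_cases hmin : IsMinimalStarProjection N p
  · exact ⟨[p], by simpa using hmin, by simp⟩
  have : ∃ q ∈ N, IsStarProjection q ∧ (p : H →L[ℂ] H) * q = q ∧ q ≠ 0 ∧ q ≠ p := by
    by_contra! hcon
    refine hmin ⟨p.2.2, p.2.1, fun q hq hq' hpq => ?_⟩
    by_contra! hne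
    exact hne.2 (hcon q hq hq' hpq hne.1)
  obtain ⟨q, hqN, hq, hpq, hq0, hqp⟩ := this
  have hpqs : IsStarProjection ((p : H →L[ℂ] H) - q) := hq.sub_of_mul_eq_right p.2.2 hpq
  obtain ⟨l₁, h₁, hs₁⟩ := ih ⟨q, hqN, hq⟩ ⟨hpq, fun h => hqp (congrArg Subtype.val h)⟩
  obtain ⟨l₂, h₂, hs₂⟩ := ih ⟨(p : H →L[ℂ] H) - q, sub_mem p.2.1 hqN, hpqs⟩
    ⟨by simp [mul_sub, hpq, p.2.2.isIdempotentElem.eq],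
      fun h => hq0 (by simpa using congrArg Subtype.val h)⟩
  refine ⟨l₁ ++ l₂, fun e he => ?_, by simp [hs₁, hs₂]⟩
  rcases List.mem_append.1 he with h | h
  exacts [h₁ e h, h₂ e h]

theorem exists_finiteDimensional_of_list {N : VonNeumannAlgebra H} (l l' : List (H →L[ℂ] H))
    (hl : ∀ e ∈ l, IsMinimalStarProjection N e) (hl' : ∀ e ∈ l', IsMinimalStarProjection N e) :
    ∃ V : Submodule ℂ (H →L[ℂ] H), FiniteDimensional ℂ V ∧
      ∀ x ∈ N, l.sum * x * l'.sum ∈ V := by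
  induction l with
  | nil => exact ⟨⊥, inferInstance, fun x _ => by simp⟩
  | cons e l ih =>
    obtain ⟨V, hV, hmem⟩ := ih fun e' he' => hl e' (List.mem_cons_of_mem _ he')
    have : ∃ W : Submodule ℂ (H →L[ℂ] H), FiniteDimensional ℂ W ∧
        ∀ x ∈ N, e * x * l'.sum ∈ W := by
      clear hmem ih
      induction l' with
      | nil => exact ⟨⊥, inferInstance, fun x _ => by simp⟩
      | cons e' l' ih' =>
        obtain ⟨W, hW, hmem⟩ := ih' (fun e hh => hl' e (List.mem_cons_of_mem _ hh))
        obtain ⟨x₀, hx₀⟩ :=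
          (hl e List.mem_cons_self).exists_mul_mul_mem_span (hl' e' List.mem_cons_self)
        refine ⟨Submodule.span ℂ {x₀} ⊔ W, inferInstance, fun x hx => ?_⟩
        rw [List.sum_cons, mul_add]
        exact Submodule.add_mem_sup (hx₀ x hx) (hmem x hx)
    obtain ⟨W, hW, hWmem⟩ := this
    refine ⟨W ⊔ V, inferInstance, fun x hx => ?_⟩
    rw [List.sum_cons, add_mul, add_mul]
    exact Submodule.add_mem_sup (hWmem x hx) (hmem x hx)

/-- An infinite-dimensional von Neumann algebra contains a sequence of nonzero, pairwise
orthogonal projections. -/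
theorem exists_orthogonal_projections {N : VonNeumannAlgebra H}
    (hinf : ¬ FiniteDimensional ℂ ↥N) :
    ∃ p : ℕ → H →L[ℂ] H, (∀ n, p n ∈ N) ∧ (∀ n, IsStarProjection (p n)) ∧
      (∀ m n, m ≠ n → p m * p n = 0) ∧ ∀ n, p n ≠ 0 := by
  by_contra hcon
  have hwf : WellFounded fun q p : {p : H →L[ℂ] H // p ∈ N ∧ IsStarProjection p} =>
      (p : H →L[ℂ] H) * q = q ∧ q ≠ p := by
    rw [wellFounded_iff_isEmpty_descending_chain]
    refine ⟨fun ⟨f, hf⟩ => hcon ?_⟩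
    have hstep : ∀ m k, (f m : H →L[ℂ] H) * f (m + k) = f (m + k) := by
      intro m k
      induction k with
      | zero => exact (f m).2.2.isIdempotentElem.eq
      | succ k ih =>
        rw [← add_assoc, ← (hf (m + k)).1, ← mul_assoc, ih]
    have hle : ∀ m n, m ≤ n → (f m : H →L[ℂ] H) * f n = f n := fun m n h => by
      simpa [Nat.add_sub_cancel' h] using hstep m (n - m)
    have hle' : ∀ m n, m ≤ n → (f n : H →L[ℂ] H) * f m = f n := fun m n h => by
      have := congrArg star (hle m n h)
      rwa [star_mul, (f m).2.2.isSelfAdjoint.star_eq, (f n).2.2.isSelfAdjoint.star_eq] at this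
    refine ⟨fun n => f n - f (n + 1), fun n => sub_mem (f n).2.1 (f (n + 1)).2.1,
      fun n => (f (n + 1)).2.2.sub_of_mul_eq_right (f n).2.2 (hf n).1, fun m n hmn => ?_,
      fun n h => (hf n).2 (Subtype.ext (sub_eq_zero.1 h).symm)⟩
    rcases lt_or_gt_of_ne hmn with h | h
    · rw [sub_mul, mul_sub, mul_sub, hle m n h.le, hle m (n + 1) (by omega),
        hle (m + 1) n h, hle (m + 1) (n + 1) (by omega), sub_self]
    · rw [sub_mul, mul_sub, mul_sub, hle' n m h.le, hle' (n + 1) m h,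
        hle' n (m + 1) (by omega), hle' (n + 1) (m + 1) (by omega), sub_self, sub_self, sub_self]
  obtain ⟨l, hl, hsum⟩ := exists_list_sum_eq_of_wellFounded hwf ⟨1, one_mem N, .one _⟩
  obtain ⟨V, hV, hmem⟩ := exists_finiteDimensional_of_list l l hl hl
  have hNV : ∀ x ∈ N, x ∈ V := fun x hx => by simpa [hsum] using hmem x hx
  refine hinf (FiniteDimensional.of_injective (V₂ := V)
    { toFun := fun x : ↥N => ⟨x, hNV x x.2⟩
      map_add' := fun _ _ => rfl
      map_smul' := fun _ _ => rfl } fun x y h => ?_)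
  exact Subtype.ext (congrArg (fun v : V => (v : H →L[ℂ] H)) h)

namespace IsPosFunctional

variable {N : VonNeumannAlgebra H} {f : ↥N →ₗ[ℂ] ℂ}

theorem map_nonneg (hf : IsPosFunctional N f) {a : ↥N} (ha : 0 ≤ (a : H →L[ℂ] H)) : 0 ≤ f a := by
  have h := hf ⟨CFC.sqrt (a : H →L[ℂ] H), sqrt_mem a.2⟩
  convert h using 2
  refine Subtype.ext ?_
  change (a : H →L[ℂ] H) = star (CFC.sqrt (a : H →L[ℂ] H)) * CFC.sqrt (a : H →L[ℂ] H)
  rw [(IsSelfAdjoint.of_nonneg (CFC.sqrt_nonneg _)).star_eq, CFC.sqrt_mul_sqrt_self _ ha]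

theorem map_mono (hf : IsPosFunctional N f) {a b : ↥N} (h : (a : H →L[ℂ] H) ≤ b) : f a ≤ f b := by
  have : 0 ≤ f (b - a) := hf.map_nonneg (sub_nonneg.2 h)
  rwa [map_sub, sub_nonneg] at this

theorem map_star (hf : IsPosFunctional N f) (x : ↥N) : f (star x) = star (f x) := by
  have h0 := (Complex.nonneg_iff.1 (hf x)).2
  have h1 := (Complex.nonneg_iff.1 (hf 1)).2
  have h2 := (Complex.nonneg_iff.1 (hf (x + 1))).2
  have h3 := (Complex.nonneg_iff.1 (hf (x + Complex.I • 1))).2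
  have e1 : star (1 : ↥N) * 1 = 1 := Subtype.ext (by simp)
  have e2 : star (x + 1) * (x + 1) = star x * x + star x + x + 1 :=
    Subtype.ext (by simp; noncomm_ring)
  have e3 : star (x + Complex.I • 1) * (x + Complex.I • 1)
      = star x * x + Complex.I • star x - Complex.I • x + 1 := by
    refine Subtype.ext ?_
    change star ((x : H →L[ℂ] H) + Complex.I • 1) * ((x : H →L[ℂ] H) + Complex.I • 1)
      = star (x : H →L[ℂ] H) * x + Complex.I • star (x : H →L[ℂ] H) - Complex.I • x + 1
    simp only [star_add, star_smul, star_one, RCLike.star_def, Complex.conj_I, add_mul, mul_add,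
      mul_smul_comm, smul_mul_assoc, mul_one, one_mul, neg_smul, smul_neg, smul_smul, smul_add,
      neg_mul, Complex.I_mul_I]
    module
  rw [e1] at h1
  rw [e2] at h2
  rw [e3] at h3
  simp only [map_add, map_sub, map_smul, smul_eq_mul, Complex.add_im, Complex.sub_im,
    Complex.mul_im, Complex.I_re, Complex.I_im] at h2 h3
  apply Complex.ext
  · simp; linarith
  · simp; linarith

/-- The Cauchy–Schwarz inequality for positive functionals. -/
theorem norm_sq_le (hf : IsPosFunctional N f) (x y : ↥N) :
    ‖f (star x * y)‖ ^ 2 ≤ (f (star x * x)).re * (f (star y * y)).re := by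
  let c : PreInnerProductSpace.Core ℂ ↥N :=
    { inner := fun x y => f (star x * y)
      conj_inner_symm := fun x y => by
        rw [← Complex.star_def, ← hf.map_star]
        congr 1
        exact Subtype.ext (by simp)
      re_inner_nonneg := fun x => (Complex.nonneg_iff.1 (hf x)).1
      add_left := fun x y z => by
        rw [← map_add]
        congr 1
        exact Subtype.ext (by simp [add_mul])
      smul_left := fun x y r => by
        rw [← smul_eq_mul ((starRingEnd ℂ) r), ← map_smul]
        congr 1
        exact Subtype.ext (by simp) }
  have h := InnerProductSpace.Core.inner_mul_inner_self_le (𝕜 := ℂ) (F := ↥N) x y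
  have hs : ‖f (star y * x)‖ = ‖f (star x * y)‖ := by
    rw [← norm_star, ← hf.map_star]
    congr 2
    exact Subtype.ext (by simp)
  calc ‖f (star x * y)‖ ^ 2 = ‖f (star x * y)‖ * ‖f (star y * x)‖ := by rw [hs, sq]
    _ ≤ _ := h

theorem eq_zero_of_map_one (hf : IsPosFunctional N f) (h1 : f 1 = 0) : f = 0 := by
  refine LinearMap.ext fun x => ?_
  have h := hf.norm_sq_le 1 x
  have e1 : star (1 : ↥N) * 1 = 1 := Subtype.ext (by simp)
  have e2 : star (1 : ↥N) * x = x := Subtype.ext (by simp)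
  rw [e1, e2, h1] at h
  have : ‖f x‖ ^ 2 ≤ 0 := by simpa using h
  simpa using this

end IsPosFunctional

namespace IsStateOn

variable {N : VonNeumannAlgebra H} {f : ↥N →ₗ[ℂ] ℂ}

theorem le_one (hf : IsStateOn N f) {a : ↥N} (h : (a : H →L[ℂ] H) ≤ 1) : f a ≤ 1 := by
  rw [← hf.2]
  exact hf.1.map_mono h

theorem norm_le (hf : IsStateOn N f) (x : ↥N) : ‖f x‖ ≤ ‖(x : H →L[ℂ] H)‖ := by
  have h := hf.1.norm_sq_le 1 x
  have e1 : star (1 : ↥N) * 1 = 1 := Subtype.ext (by simp)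
  have e2 : star (1 : ↥N) * x = x := Subtype.ext (by simp)
  rw [e1, e2, hf.2, Complex.one_re, one_mul] at h
  have h2 : f (star x * x) ≤ f (((‖(x : H →L[ℂ] H)‖ ^ 2 : ℝ) : ℂ) • (1 : ↥N)) := by
    refine hf.1.map_mono ?_
    have := CStarAlgebra.star_mul_le_algebraMap_norm_sq (a := (x : H →L[ℂ] H))
    simpa [Algebra.algebraMap_eq_smul_one, ← Complex.coe_smul] using this
  rw [map_smul, hf.2, smul_eq_mul, mul_one] at h2
  exact le_of_sq_le_sq (h.trans (Complex.le_def.1 h2).1) (norm_nonneg _)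

theorem map_mul_right (hf : IsStateOn N f) {r : ↥N} (h0 : 0 ≤ (r : H →L[ℂ] H))
    (h1 : (r : H →L[ℂ] H) ≤ 1) (hr : f r = 1) (x : ↥N) : f (x * r) = f x := by
  have hs : star (r : H →L[ℂ] H) = r := (IsSelfAdjoint.of_nonneg h0).star_eq
  have h := hf.1.norm_sq_le (star x) (1 - r)
  have hz : f (star (1 - r) * (1 - r)) ≤ f (1 - r) := by
    refine hf.1.map_mono ?_
    change star (1 - (r : H →L[ℂ] H)) * (1 - (r : H →L[ℂ] H)) ≤ 1 - (r : H →L[ℂ] H)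
    have h1' : 0 ≤ 1 - (r : H →L[ℂ] H) := sub_nonneg.2 h1
    have hle : 1 - (r : H →L[ℂ] H) ≤ 1 := sub_le_self _ h0
    rw [(IsSelfAdjoint.of_nonneg h1').star_eq, ← sq]
    simpa using CStarAlgebra.pow_antitone h1' hle (show 1 ≤ 2 by norm_num)
  rw [map_sub, hf.2, hr, sub_self] at hz
  have hz' : (f (star (1 - r) * (1 - r))).re = 0 :=
    le_antisymm (Complex.le_def.1 hz).1 (Complex.nonneg_iff.1 (hf.1 _)).1
  rw [hz', mul_zero] at h
  have h3 : f (star (star x) * (1 - r)) = 0 := by simpa using h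
  have e : star (star x) * (1 - r) = x - x * r := Subtype.ext (by simp [mul_sub])
  rw [e, map_sub, sub_eq_zero] at h3
  exact h3.symm

theorem map_mul_left (hf : IsStateOn N f) {r : ↥N} (h0 : 0 ≤ (r : H →L[ℂ] H))
    (h1 : (r : H →L[ℂ] H) ≤ 1) (hr : f r = 1) (x : ↥N) : f (r * x) = f x := by
  have h := congrArg star (hf.map_mul_right h0 h1 hr (star x))
  rw [← hf.1.map_star, ← hf.1.map_star] at h
  have hs : star (r : H →L[ℂ] H) = r := (IsSelfAdjoint.of_nonneg h0).star_eq
  have e1 : star (star x * r) = r * x := Subtype.ext (by simp [hs])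
  have e2 : star (star x) = x := Subtype.ext (by simp)
  rwa [e1, e2] at h

end IsStateOn

/-- The state space of `N`, as a set of functions on `N`. -/
def stateSet (N : VonNeumannAlgebra H) : Set (↥N → ℂ) :=
  {φ | ∃ f : ↥N →ₗ[ℂ] ℂ, IsStateOn N f ∧ ⇑f = φ}

theorem isCompact_stateSet (N : VonNeumannAlgebra H) : IsCompact (stateSet N) := by
  have hK : IsCompact (Set.pi Set.univ fun x : ↥N => Metric.closedBall (0 : ℂ) ‖(x : H →L[ℂ] H)‖) :=
    isCompact_univ_pi fun x => isCompact_closedBall _ _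
  refine hK.of_isClosed_subset ?_ ?_
  · have h1 : IsClosed (Set.range ((⇑) : (↥N →ₗ[ℂ] ℂ) → ↥N → ℂ)) :=
      LinearMap.isClosed_range_coe _ _ (RingHom.id ℂ)
    have h2 : IsClosed {φ : ↥N → ℂ | ∀ a : ↥N, 0 ≤ φ (star a * a)} := by
      simp only [Set.ofPred_forall]
      exact isClosed_iInter fun a => isClosed_le continuous_const (continuous_apply _)
    have h3 : IsClosed {φ : ↥N → ℂ | φ 1 = 1} :=
      isClosed_eq (continuous_apply _) continuous_const
    have e : stateSet N = Set.range ((⇑) : (↥N →ₗ[ℂ] ℂ) → ↥N → ℂ) ∩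
        ({φ : ↥N → ℂ | ∀ a : ↥N, 0 ≤ φ (star a * a)} ∩ {φ : ↥N → ℂ | φ 1 = 1}) := by
      ext φ
      constructor
      · rintro ⟨f, hf, rfl⟩
        exact ⟨⟨f, rfl⟩, hf.1, hf.2⟩
      · rintro ⟨⟨f, rfl⟩, ha, hb⟩
        exact ⟨f, ⟨ha, hb⟩, rfl⟩
    rw [e]
    exact h1.inter (h2.inter h3)
  · rintro φ ⟨f, hf, rfl⟩ x -
    simpa using hf.norm_le x

theorem exists_isPureStateOn {N : VonNeumannAlgebra H} (A : Set ↥N)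
    (hA : ∀ a ∈ A, (a : H →L[ℂ] H) ≤ 1)
    (hfin : ∀ s : Finset ↥N, (s : Set ↥N) ⊆ A → ∃ f, IsStateOn N f ∧ ∀ a ∈ s, f a = 1) :
    ∃ f, IsPureStateOn N f ∧ ∀ a ∈ A, f a = 1 := by
  classical
  let K : Set (↥N → ℂ) := stateSet N ∩ ⋂ a : A, {φ | φ a = 1}
  have hcl : ∀ a : A, IsClosed {φ : ↥N → ℂ | φ a = 1} := fun a =>
    isClosed_eq (continuous_apply _) continuous_const
  have hKc : IsCompact K := (isCompact_stateSet N).inter_right (isClosed_iInter hcl)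
  have hKn : K.Nonempty := by
    refine (isCompact_stateSet N).inter_iInter_nonempty _ hcl fun u => ?_
    obtain ⟨f, hf, hfu⟩ := hfin (u.image Subtype.val) (by
      intro x hx
      simp only [Finset.coe_image, Set.mem_image] at hx
      obtain ⟨y, -, rfl⟩ := hx
      exact y.2)
    refine ⟨f, ⟨f, hf, rfl⟩, ?_⟩
    simp only [Set.mem_iInter, Set.mem_ofPred_eq]
    exact fun a ha => hfu a (Finset.mem_image_of_mem _ ha)
  obtain ⟨φ, ⟨⟨⟨f, hf, rfl⟩, hfA⟩, hext⟩⟩ := hKc.extremePoints_nonempty hKn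
  have hfA' : ∀ a ∈ A, f a = 1 := fun a ha => Set.mem_iInter.1 hfA ⟨a, ha⟩
  refine ⟨f, ⟨hf, fun g hg hfg => ?_⟩, hfA'⟩
  have e1 : star (1 : ↥N) * 1 = 1 := Subtype.ext (by simp)
  have hg1 := hg 1
  have hfg1 := hfg 1
  rw [e1] at hg1 hfg1
  rw [LinearMap.sub_apply, hf.2] at hfg1
  obtain ⟨s, hs⟩ : ∃ s : ℝ, g 1 = s := ⟨(g 1).re, by
    apply Complex.ext
    · simp
    · simpa using (Complex.nonneg_iff.1 hg1).2.symm⟩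
  rw [hs] at hg1 hfg1
  have hs0 : 0 ≤ s := by exact_mod_cast hg1
  have hs1 : s ≤ 1 := by
    have : (0 : ℂ) ≤ ((1 - s : ℝ) : ℂ) := by push_cast; exact hfg1
    have : (0 : ℝ) ≤ 1 - s := by exact_mod_cast this
    linarith
  refine ⟨s, hs0, ?_⟩
  rcases hs0.eq_or_lt with h | hs0'
  · rw [← h]
    rw [← h] at hs
    simpa using hg.eq_zero_of_map_one (by simpa using hs)
  rcases hs1.eq_or_lt with h | hs1'
  · have := hfg.eq_zero_of_map_one (by rw [LinearMap.sub_apply, hf.2, hs, h]; simp)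
    rw [h]
    simpa using (sub_eq_zero.1 this).symm
  have hsne : (s : ℂ) ≠ 0 := by exact_mod_cast hs0'.ne'
  have hsne' : ((1 - s : ℝ) : ℂ) ≠ 0 := by exact_mod_cast (sub_pos.2 hs1').ne'
  have mk : ∀ (k : ↥N →ₗ[ℂ] ℂ) (c : ℝ), 0 < c → IsPosFunctional N k → k 1 = c →
      IsStateOn N (((c⁻¹ : ℝ) : ℂ) • k) := by
    intro k c hc hk hk1
    refine ⟨fun a => ?_, ?_⟩
    · rw [LinearMap.smul_apply, smul_eq_mul]
      exact mul_nonneg (by exact_mod_cast (inv_nonneg.2 hc.le)) (hk a)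
    · have : (c : ℂ) ≠ 0 := by exact_mod_cast hc.ne'
      rw [LinearMap.smul_apply, smul_eq_mul, hk1]
      push_cast
      exact inv_mul_cancel₀ this
  have hu := mk g s hs0' hg hs
  have hv := mk (f - g) (1 - s) (sub_pos.2 hs1') hfg (by
    rw [LinearMap.sub_apply, hf.2, hs]; push_cast; rfl)
  set u := ((s⁻¹ : ℝ) : ℂ) • g with hudef
  set v := (((1 - s)⁻¹ : ℝ) : ℂ) • (f - g) with hvdef
  have hcomb : ∀ x, f x = s * u x + (1 - s : ℝ) * v x := by
    intro x
    simp only [hudef, hvdef, LinearMap.smul_apply, smul_eq_mul, LinearMap.sub_apply]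
    push_cast at hsne' ⊢
    field_simp
    ring
  have key : ∀ (u v : ↥N →ₗ[ℂ] ℂ) (s : ℝ), 0 < s → s < 1 → IsStateOn N u → IsStateOn N v →
      (∀ x, f x = s * u x + (1 - s : ℝ) * v x) → ∀ a ∈ A, u a = 1 := by
    intro u v s hs0 hs1 hu hv hc a ha
    have h1 := hu.le_one (hA a ha)
    have h2 := hv.le_one (hA a ha)
    have h3 := hc a
    rw [hfA' a ha] at h3
    rw [Complex.le_def] at h1 h2
    have h4 := congrArg Complex.re h3
    simp only [Complex.add_re, Complex.re_ofReal_mul, Complex.one_re] at h4 h1 h2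
    refine Complex.ext ?_ h1.2
    rw [Complex.one_re]
    nlinarith [h1.1, h2.1]
  have huA := key u v s hs0' hs1' hu hv hcomb
  have hvA := key v u (1 - s) (by linarith) (by linarith) hv hu (fun x => by
    rw [hcomb x]; push_cast; ring)
  have := hext (x₁ := ⇑u) ⟨⟨u, hu, rfl⟩, Set.mem_iInter.2 fun a => huA a a.2⟩
    (x₂ := ⇑v) ⟨⟨v, hv, rfl⟩, Set.mem_iInter.2 fun a => hvA a a.2⟩
    ⟨s, 1 - s, hs0', sub_pos.2 hs1', by ring, by
      funext x
      simp only [Pi.add_apply, Pi.smul_apply, Complex.real_smul]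
      exact (hcomb x).symm⟩
  refine LinearMap.ext fun x => ?_
  have hx := congrFun this x
  rw [LinearMap.smul_apply, smul_eq_mul, ← hx, hudef, LinearMap.smul_apply, smul_eq_mul]
  push_cast
  field_simp

/-- The vector functional `x ↦ ⟪ξ, x ξ⟫` on `N`. -/
noncomputable def vectorFunctional (N : VonNeumannAlgebra H) (ξ : H) : ↥N →ₗ[ℂ] ℂ where
  toFun x := ⟪ξ, (x : H →L[ℂ] H) ξ⟫_ℂ
  map_add' x y := by simp
  map_smul' c x := by simp

theorem vectorFunctional_apply (N : VonNeumannAlgebra H) (ξ : H) (x : ↥N) :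
    vectorFunctional N ξ x = ⟪ξ, (x : H →L[ℂ] H) ξ⟫_ℂ := rfl

theorem isStateOn_vectorFunctional (N : VonNeumannAlgebra H) {ξ : H} (hξ : ‖ξ‖ = 1) :
    IsStateOn N (vectorFunctional N ξ) := by
  refine ⟨fun a => ?_, ?_⟩
  · rw [vectorFunctional_apply]
    change 0 ≤ ⟪ξ, (star (a : H →L[ℂ] H) * a) ξ⟫_ℂ
    rw [ContinuousLinearMap.star_eq_adjoint, mul_apply_eq_comp,
      ContinuousLinearMap.adjoint_inner_right, inner_self_eq_norm_sq_to_K]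
    exact pow_nonneg (Complex.zero_le_real.2 (norm_nonneg ((a : H →L[ℂ] H) ξ))) 2
  · rw [vectorFunctional_apply]
    change ⟪ξ, ξ⟫_ℂ = 1
    rw [inner_self_eq_norm_sq_to_K, hξ]
    simp

theorem exists_isStateOn_eq_one {N : VonNeumannAlgebra H} {b : ↥N}
    (hb : (b : H →L[ℂ] H) ≤ 1)
    (h : ∀ δ > (0 : ℝ), ∃ η : H, η ≠ 0 ∧ (1 - δ) * ‖η‖ ^ 2 ≤ (⟪η, (b : H →L[ℂ] H) η⟫_ℂ).re) :
    ∃ f, IsStateOn N f ∧ f b = 1 := by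
  have unit : ∀ δ > (0 : ℝ), ∃ f, IsStateOn N f ∧ 1 - δ ≤ (f b).re := by
    intro δ hδ
    obtain ⟨η, h0, hη⟩ := h δ hδ
    have hn : ‖η‖ ≠ 0 := norm_ne_zero_iff.2 h0
    refine ⟨vectorFunctional N ((‖η‖⁻¹ : ℂ) • η), isStateOn_vectorFunctional N ?_, ?_⟩
    · rw [norm_smul]
      simp [hn]
    · rw [vectorFunctional_apply, map_smul, inner_smul_left, inner_smul_right, ← mul_assoc]
      have : (starRingEnd ℂ) (‖η‖ : ℂ)⁻¹ * (‖η‖ : ℂ)⁻¹ = (((‖η‖ ^ 2)⁻¹ : ℝ) : ℂ) := by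
        simp only [map_inv₀, Complex.conj_ofReal]
        push_cast
        rw [sq, mul_inv]
      rw [this, Complex.re_ofReal_mul, mul_comm, ← div_eq_mul_inv, le_div_iff₀ (by positivity)]
      exact hη
  obtain ⟨f₀, hf₀, -⟩ := unit 1 one_pos
  obtain ⟨φ, ⟨f, hf, rfl⟩, hmax⟩ := (isCompact_stateSet N).exists_isMaxOn ⟨f₀, f₀, hf₀, rfl⟩
    (f := fun φ : ↥N → ℂ => (φ b).re)
    (Complex.continuous_re.comp (continuous_apply b)).continuousOn
  refine ⟨f, hf, ?_⟩
  have h1 := Complex.le_def.1 (hf.le_one hb)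
  refine Complex.ext (le_antisymm h1.1 ?_) h1.2
  refine le_of_forall_pos_lt_add fun δ hδ => ?_
  obtain ⟨g, hg, hgb⟩ := unit (δ / 2) (by linarith)
  have h2 : (g b).re ≤ (f b).re := hmax (show ⇑g ∈ stateSet N from ⟨g, hg, rfl⟩)
  rw [Complex.one_re]
  linarith

/-- An effect of `N`: an element `a` with `0 ≤ a ≤ 1`. -/
def IsEffect {N : VonNeumannAlgebra H} (a : ↥N) : Prop :=
  0 ≤ (a : H →L[ℂ] H) ∧ (a : H →L[ℂ] H) ≤ 1

theorem IsStarProjection.isEffect {N : VonNeumannAlgebra H} {p : H →L[ℂ] H}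
    (hp : IsStarProjection p) (hpN : p ∈ N) : IsEffect (⟨p, hpN⟩ : ↥N) :=
  ⟨hp.nonneg, hp.le_one⟩

theorem isClosed_coe_vonNeumannAlgebra (N : VonNeumannAlgebra H) :
    IsClosed (N : Set (H →L[ℂ] H)) := by
  have e : (N : Set (H →L[ℂ] H)) = ⋂ y ∈ N.commutant, {x : H →L[ℂ] H | x * y = y * x} := by
    ext x
    simp only [Set.mem_iInter, Set.mem_ofPred_eq, SetLike.mem_coe]
    constructor
    · intro hx y hy
      exact N.commute_of_mem_commutant hx hy
    · intro h
      exact VonNeumannAlgebra.mem_of_forall_commute fun y hy => h y hy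
  rw [e]
  exact isClosed_biInter fun y _ =>
    isClosed_eq (continuous_id.mul continuous_const) (continuous_const.mul continuous_id)

/-- A sequence of effects can be replaced by a single effect, with the same states of value `1`. -/
theorem exists_effect_forall_eq_one {N : VonNeumannAlgebra H} (a : ℕ → ↥N)
    (ha : ∀ k, IsEffect (a k)) :
    ∃ b : ↥N, IsEffect b ∧ ∀ f, IsStateOn N f → (f b = 1 ↔ ∀ k, f (a k) = 1) := by
  have hc : HasSum (fun k : ℕ => (1 / 2 : ℝ) ^ (k + 1)) 1 := by
    simpa [pow_succ] using hasSum_geometric_two.mul_right (1 / 2 : ℝ)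
  set c : ℕ → ℝ := fun k => (1 / 2 : ℝ) ^ (k + 1) with hcdef
  have hc0 : ∀ k, 0 < c k := fun k => by positivity
  have hnorm : ∀ k, ‖(a k : H →L[ℂ] H)‖ ≤ 1 := fun k =>
    (CStarAlgebra.norm_le_one_iff_of_nonneg _ (ha k).1).2 (ha k).2
  have hsum : Summable fun k => c k • (a k : H →L[ℂ] H) := by
    refine Summable.of_norm_bounded hc.summable fun k => ?_
    rw [norm_smul, Real.norm_of_nonneg (hc0 k).le]
    exact mul_le_of_le_one_right (hc0 k).le (hnorm k)
  obtain ⟨b, hb⟩ := hsum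
  have h1 : HasSum (fun k => c k • (1 : H →L[ℂ] H)) 1 := by
    simpa using hc.smul_const (1 : H →L[ℂ] H)
  have hsub : HasSum (fun k => c k • (1 - (a k : H →L[ℂ] H))) (1 - b) := by
    simpa [smul_sub] using h1.sub hb
  have hpos : ∀ k, 0 ≤ c k • (a k : H →L[ℂ] H) := fun k => smul_nonneg (hc0 k).le (ha k).1
  have hpos' : ∀ k, 0 ≤ c k • (1 - (a k : H →L[ℂ] H)) := fun k =>
    smul_nonneg (hc0 k).le (sub_nonneg.2 (ha k).2)
  have hsm : ∀ (r : ℝ) (x : ↥N), (((r : ℂ) • x : ↥N) : H →L[ℂ] H) = r • (x : H →L[ℂ] H) :=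
    fun r x => by
      change (r : ℂ) • (x : H →L[ℂ] H) = _
      exact Complex.coe_smul r (x : H →L[ℂ] H)
  have hpart : ∀ s : Finset ℕ, ((∑ k ∈ s, (c k : ℂ) • a k : ↥N) : H →L[ℂ] H)
      = ∑ k ∈ s, c k • (a k : H →L[ℂ] H) := fun s => by
    rw [AddSubmonoidClass.coe_finsetSum]
    exact Finset.sum_congr rfl fun k _ => hsm _ _
  have hbN : b ∈ N := (isClosed_coe_vonNeumannAlgebra N).mem_of_tendsto hb
    (Eventually.of_forall fun s => by
      rw [← hpart]
      exact SetLike.coe_mem _)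
  have hbe : IsEffect (⟨b, hbN⟩ : ↥N) :=
    ⟨hb.nonneg hpos, sub_nonneg.1 (hsub.nonneg hpos')⟩
  refine ⟨⟨b, hbN⟩, hbe, fun f hf => ⟨fun h k => ?_, fun h => ?_⟩⟩
  · have hle : f ((c k : ℂ) • (1 - a k)) ≤ f (1 - ⟨b, hbN⟩) := by
      refine hf.1.map_mono ?_
      rw [hsm]
      exact le_hasSum hsub k fun j _ => hpos' j
    rw [map_smul, map_sub, map_sub, hf.2, h, sub_self, smul_eq_mul] at hle
    have h2 := Complex.le_def.1 (hf.le_one (ha k).2)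
    have h3 := (Complex.le_def.1 hle).1
    rw [Complex.re_ofReal_mul, Complex.sub_re, Complex.one_re, Complex.zero_re] at h3
    refine Complex.ext (le_antisymm h2.1 ?_) h2.2
    rw [Complex.one_re]
    by_contra hlt
    nlinarith [mul_pos (hc0 k) (sub_pos.2 (not_le.1 hlt))]
  · have h2 := Complex.le_def.1 (hf.le_one hbe.2)
    refine Complex.ext (le_antisymm h2.1 ?_) h2.2
    rw [Complex.one_re]
    refine le_of_tendsto' hc.tendsto_sum_nat fun n => ?_
    have hle : f (∑ k ∈ Finset.range n, (c k : ℂ) • a k) ≤ f ⟨b, hbN⟩ := by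
      refine hf.1.map_mono ?_
      rw [hpart]
      exact sum_le_hasSum _ (fun j _ => hpos j) hb
    rw [map_sum] at hle
    have : ∑ k ∈ Finset.range n, f ((c k : ℂ) • a k) = ((∑ k ∈ Finset.range n, c k : ℝ) : ℂ) := by
      push_cast
      exact Finset.sum_congr rfl fun k _ => by rw [map_smul, h k, smul_eq_mul, mul_one]
    rw [this] at hle
    exact (Complex.le_def.1 hle).1

/-- The average of two elements of `N`. -/
noncomputable def effectAvg {N : VonNeumannAlgebra H} (a b : ↥N) : ↥N := (1 / 2 : ℂ) • (a + b)

theorem coe_effectAvg {N : VonNeumannAlgebra H} (a b : ↥N) :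
    (effectAvg a b : H →L[ℂ] H) = (1 / 2 : ℝ) • ((a : H →L[ℂ] H) + b) := by
  change (1 / 2 : ℂ) • ((a : H →L[ℂ] H) + b) = _
  rw [← Complex.coe_smul (1 / 2 : ℝ) ((a : H →L[ℂ] H) + b)]
  norm_num

theorem IsEffect.effectAvg {N : VonNeumannAlgebra H} {a b : ↥N} (ha : IsEffect a)
    (hb : IsEffect b) : IsEffect (effectAvg a b) := by
  refine ⟨?_, ?_⟩
  · rw [coe_effectAvg]
    exact smul_nonneg (by norm_num) (add_nonneg ha.1 hb.1)
  · rw [coe_effectAvg]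
    calc (1 / 2 : ℝ) • ((a : H →L[ℂ] H) + b) ≤ (1 / 2 : ℝ) • ((1 : H →L[ℂ] H) + 1) :=
          smul_le_smul_of_nonneg_left (add_le_add ha.2 hb.2) (by norm_num)
      _ = 1 := by rw [← two_smul ℝ, smul_smul]; norm_num

theorem IsStateOn.effectAvg_eq_one {N : VonNeumannAlgebra H} {f : ↥N →ₗ[ℂ] ℂ} {a b : ↥N}
    (hf : IsStateOn N f) (ha : IsEffect a) (hb : IsEffect b) (h : f (effectAvg a b) = 1) :
    f a = 1 ∧ f b = 1 := by
  rw [effectAvg, map_smul, map_add, smul_eq_mul] at h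
  have h1 := Complex.le_def.1 (hf.le_one ha.2)
  have h2 := Complex.le_def.1 (hf.le_one hb.2)
  have h3 : f a + f b = 2 := by linear_combination 2 * h
  have h4 := congrArg Complex.re h3
  simp only [Complex.add_re, Complex.re_ofNat, Complex.one_re] at h4 h1 h2
  refine ⟨Complex.ext ?_ h1.2, Complex.ext ?_ h2.2⟩ <;> rw [Complex.one_re] <;> linarith [h1.1, h2.1]

/-- A sequence of pairwise orthogonal projections of `N` (some of which may vanish) whose
supremum is the identity. -/
structure IsPartition (N : VonNeumannAlgebra H) (p : ℕ → H →L[ℂ] H) : Prop where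
  mem : ∀ n, p n ∈ N
  proj : ∀ n, IsStarProjection (p n)
  orth : ∀ m n, m ≠ n → p m * p n = 0
  sup : rangeSup p = 1

theorem IsStarProjection.norm_apply_le {e : H →L[ℂ] H} (he : IsStarProjection e) (ξ : H) :
    ‖e ξ‖ ≤ ‖ξ‖ := by
  have h := (CStarAlgebra.norm_le_one_iff_of_nonneg _ he.nonneg).2 he.le_one
  simpa using (e.le_opNorm ξ).trans (mul_le_of_le_one_left (norm_nonneg ξ) h)

theorem IsSelfAdjoint.inner_apply_left {x : H →L[ℂ] H} (hx : IsSelfAdjoint x) (ξ η : H) :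
    ⟪x ξ, η⟫_ℂ = ⟪ξ, x η⟫_ℂ := by
  rw [← ContinuousLinearMap.adjoint_inner_right, ← ContinuousLinearMap.star_eq_adjoint, hx.star_eq]

theorem IsSelfAdjoint.real_smul {x : H →L[ℂ] H} (hx : IsSelfAdjoint x) (r : ℝ) :
    IsSelfAdjoint (r • x) := by
  change star (r • x) = r • x
  rw [← Complex.coe_smul, star_smul, hx.star_eq, RCLike.star_def, Complex.conj_ofReal]

namespace IsPartition

variable {N : VonNeumannAlgebra H} {p : ℕ → H →L[ℂ] H}

theorem sum_mul_of_mem (hp : IsPartition N p) {F : Finset ℕ} {n : ℕ} (hn : n ∈ F) :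
    (∑ k ∈ F, p k) * p n = p n := by
  rw [Finset.sum_mul, Finset.sum_eq_single n (fun k _ hk => hp.orth k n hk) (fun h => absurd hn h),
    (hp.proj n).isIdempotentElem.eq]

theorem isStarProjection_sum (hp : IsPartition N p) (F : Finset ℕ) :
    IsStarProjection (∑ k ∈ F, p k) where
  isIdempotentElem := by
    change (∑ k ∈ F, p k) * ∑ k ∈ F, p k = _
    rw [Finset.mul_sum]
    exact Finset.sum_congr rfl fun n hn => hp.sum_mul_of_mem hn
  isSelfAdjoint := by
    change star (∑ k ∈ F, p k) = _
    rw [star_sum]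
    exact Finset.sum_congr rfl fun n _ => (hp.proj n).isSelfAdjoint.star_eq

theorem tendsto_sum (hp : IsPartition N p) (ξ : H) :
    Tendsto (fun M => (∑ k ∈ Finset.range M, p k) ξ) atTop (𝓝 ξ) := by
  have hfin : ∀ ζ ∈ ⨆ i, (p i).range, ∃ M₀, ∀ M ≥ M₀, (∑ k ∈ Finset.range M, p k) ζ = ζ := by
    intro ζ hζ
    refine Submodule.iSup_induction (motive := fun ζ => ∃ M₀, ∀ M ≥ M₀,
      (∑ k ∈ Finset.range M, p k) ζ = ζ) _ hζ ?_ ?_ ?_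
    · rintro n _ ⟨ζ, rfl⟩
      exact ⟨n + 1, fun M hM => DFunLike.congr_fun
        (hp.sum_mul_of_mem (Finset.mem_range.2 (by omega))) ζ⟩
    · exact ⟨0, fun M _ => map_zero _⟩
    · rintro x y ⟨M₁, h₁⟩ ⟨M₂, h₂⟩
      refine ⟨max M₁ M₂, fun M hM => ?_⟩
      rw [map_add, h₁ M (le_trans (le_max_left _ _) hM), h₂ M (le_trans (le_max_right _ _) hM)]
  have hξ : ξ ∈ closure ((⨆ i, (p i).range : Submodule ℂ H) : Set H) := by
    have h : rangeSup p ξ = ξ := by rw [hp.sup]; rfl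
    exact Submodule.starProjection_eq_self_iff.1 h
  rw [Metric.tendsto_atTop]
  intro ε hε
  obtain ⟨ζ, hζ, hd⟩ := Metric.mem_closure_iff.1 hξ (ε / 2) (by linarith)
  obtain ⟨M₀, hM₀⟩ := hfin ζ hζ
  refine ⟨M₀, fun M hM => ?_⟩
  have h1 : dist ((∑ k ∈ Finset.range M, p k) ξ) ζ ≤ dist ξ ζ := by
    rw [dist_eq_norm, dist_eq_norm]
    conv_lhs => rw [← hM₀ M hM, ← map_sub]
    exact (hp.isStarProjection_sum _).norm_apply_le _
  calc dist ((∑ k ∈ Finset.range M, p k) ξ) ξ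
      ≤ dist ((∑ k ∈ Finset.range M, p k) ξ) ζ + dist ζ ξ := dist_triangle _ _ _
    _ ≤ dist ξ ζ + dist ξ ζ := add_le_add h1 (dist_comm _ _).le
    _ < ε := by linarith

theorem exists_vector (hp : IsPartition N p) {a : ↥N} {f : ↥N →ₗ[ℂ] ℂ}
    (hf : IsStateOn N f) (ha : IsEffect a) (hfa : f a = 1) (hfp : ∀ n, f ⟨p n, hp.mem n⟩ = 0)
    (m : ℕ) {ε : ℝ} (h0 : 0 < ε) (h1 : ε ≤ 1) :
    ∃ M ≥ m, ∃ ζ, (∑ k ∈ Finset.Ico m M, p k) ζ = ζ ∧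
      (1 - ε) * ‖ζ‖ ^ 2 < (⟪ζ, (a : H →L[ℂ] H) ζ⟫_ℂ).re := by
  set E : ℕ → H →L[ℂ] H := fun M => ∑ k ∈ Finset.range M, p k with hE
  have hEp : ∀ M, IsStarProjection (E M) := fun M => hp.isStarProjection_sum _
  have hEN : ∀ M, E M ∈ N := fun M => sum_mem fun k _ => hp.mem k
  have hQ : IsStarProjection (1 - E m) := (hEp m).one_sub
  have has : IsSelfAdjoint (a : H →L[ℂ] H) := .of_nonneg ha.1
  have hfE : f ⟨E m, hEN m⟩ = 0 := by
    have e : (⟨E m, hEN m⟩ : ↥N) = ∑ k ∈ Finset.range m, ⟨p k, hp.mem k⟩ :=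
      Subtype.ext (by rw [AddSubmonoidClass.coe_finsetSum])
    rw [e, map_sum]
    exact Finset.sum_eq_zero fun k _ => hfp k
  set Q : ↥N := 1 - ⟨E m, hEN m⟩ with hQdef
  have hQc : (Q : H →L[ℂ] H) = 1 - E m := rfl
  have hfQ : f Q = 1 := by rw [hQdef, map_sub, hf.2, hfE, sub_zero]
  have hfQaQ : f (Q * a * Q) = 1 := by
    rw [hf.map_mul_right (hQc ▸ hQ.nonneg) (hQc ▸ hQ.le_one) hfQ,
      hf.map_mul_left (hQc ▸ hQ.nonneg) (hQc ▸ hQ.le_one) hfQ, hfa]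
  obtain ⟨ζ, hζ⟩ : ∃ ζ, (1 - ε) * ‖ζ‖ ^ 2 < (⟪ζ, ((1 - E m) * a * (1 - E m)) ζ⟫_ℂ).re := by
    by_contra! hcon
    have hle : (1 - E m) * (a : H →L[ℂ] H) * (1 - E m) ≤ (1 - ε) • (1 : H →L[ℂ] H) := by
      refine le_of_forall_re_inner_le ?_ ?_ fun ξ => (hcon ξ).trans (le_of_eq ?_)
      · have := has.conjugate (1 - E m)
        rwa [hQ.isSelfAdjoint.star_eq] at this
      · exact (IsSelfAdjoint.one (H →L[ℂ] H)).real_smul (1 - ε)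
      · rw [smul_apply, one_apply_eq_self, inner_smul_right_eq_smul,
          Complex.real_smul, Complex.re_ofReal_mul, inner_self_eq_norm_sq_to_K]
        norm_cast
    have hle' : f (Q * a * Q) ≤ f (((1 - ε : ℝ) : ℂ) • (1 : ↥N)) := by
      refine hf.1.map_mono (le_trans hle (le_of_eq ?_))
      exact (Complex.coe_smul (1 - ε) (1 : H →L[ℂ] H)).symm
    rw [hfQaQ, map_smul, hf.2, smul_eq_mul, mul_one] at hle'
    have := (Complex.le_def.1 hle').1
    simp only [Complex.one_re, Complex.ofReal_re] at this
    linarith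
  set ξ := (1 - E m) ζ with hξ
  have hξ1 : (1 - ε) * ‖ξ‖ ^ 2 < (⟪ξ, (a : H →L[ℂ] H) ξ⟫_ℂ).re := by
    have e : ⟪ζ, ((1 - E m) * a * (1 - E m)) ζ⟫_ℂ = ⟪ξ, (a : H →L[ℂ] H) ξ⟫_ℂ := by
      rw [hξ, hQ.isSelfAdjoint.inner_apply_left]
      rfl
    rw [e] at hζ
    refine lt_of_le_of_lt ?_ hζ
    have : ‖ξ‖ ≤ ‖ζ‖ := hQ.norm_apply_le ζ
    gcongr
  have ht : Tendsto (fun M => E M ξ) atTop (𝓝 ξ) := hp.tendsto_sum ξ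
  have ht1 : Tendsto (fun M => (1 - ε) * ‖E M ξ‖ ^ 2) atTop (𝓝 ((1 - ε) * ‖ξ‖ ^ 2)) :=
    (ht.norm.pow 2).const_mul _
  have ht2 : Tendsto (fun M => (⟪E M ξ, (a : H →L[ℂ] H) (E M ξ)⟫_ℂ).re) atTop
      (𝓝 (⟪ξ, (a : H →L[ℂ] H) ξ⟫_ℂ).re) :=
    (Complex.continuous_re.tendsto _).comp
      (ht.inner (((a : H →L[ℂ] H).continuous.tendsto _).comp ht))
  obtain ⟨M, hM, hMm⟩ := ((ht1.eventually_lt ht2 hξ1).and (eventually_ge_atTop m)).exists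
  refine ⟨M, hMm, E M ξ, ?_, hM⟩
  have hI : ∑ k ∈ Finset.Ico m M, p k = E M - E m := Finset.sum_Ico_eq_sub _ hMm
  have hmM : E m * E M = E m := by
    have h2 : E M * E m = E m := by
      simp only [hE]
      rw [Finset.mul_sum]
      exact Finset.sum_congr rfl fun n hn => hp.sum_mul_of_mem
        (Finset.mem_range.2 (lt_of_lt_of_le (Finset.mem_range.1 hn) hMm))
    have := congrArg star h2
    rwa [star_mul, (hEp m).isSelfAdjoint.star_eq, (hEp M).isSelfAdjoint.star_eq] at this
  have hmm := (hEp m).isIdempotentElem.eq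
  have hMM := (hEp M).isIdempotentElem.eq
  have key : (E M - E m) * E M * (1 - E m) = E M * (1 - E m) := by
    rw [sub_mul, hMM, hmM, sub_mul, mul_sub (E m), mul_one, hmm, sub_self, sub_zero]
  rw [hI, hξ]
  exact DFunLike.congr_fun key ζ

/-- If a state with `f a = 1` kills all members of a partition, then far-out blocks of the
partition contain vectors almost fixed by `a`, and these can be chosen in the range of an element
of `N`. -/
theorem exists_block (hp : IsPartition N p) {a : ↥N} {f : ↥N →ₗ[ℂ] ℂ}
    (hf : IsStateOn N f) (ha : IsEffect a) (hfa : f a = 1) (hfp : ∀ n, f ⟨p n, hp.mem n⟩ = 0)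
    (m : ℕ) {ε : ℝ} (h0 : 0 < ε) (h1 : ε ≤ 1) :
    ∃ M ≥ m, ∃ y ∈ N, IsSelfAdjoint y ∧ y ≠ 0 ∧ (∑ k ∈ Finset.Ico m M, p k) * y = y ∧
      ∀ ξ, (1 - ε) * ‖y ξ‖ ^ 2 ≤ (⟪y ξ, (a : H →L[ℂ] H) (y ξ)⟫_ℂ).re := by
  obtain ⟨M, hM, ζ, hζ, hlt⟩ := hp.exists_vector hf ha hfa hfp m h0 h1
  have hP := hp.isStarProjection_sum (Finset.Ico m M)
  have hPN : ∑ k ∈ Finset.Ico m M, p k ∈ N := sum_mem fun k _ => hp.mem k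
  set P := ∑ k ∈ Finset.Ico m M, p k with hPdef
  have has : IsSelfAdjoint (a : H →L[ℂ] H) := .of_nonneg ha.1
  have hPs := hP.isSelfAdjoint
  have hPP := hP.isIdempotentElem.eq
  set d : H →L[ℂ] H := P * a * P - (1 - ε) • P with hd
  have hds : IsSelfAdjoint d := by
    refine IsSelfAdjoint.sub ?_ (hPs.real_smul (1 - ε))
    have := has.conjugate P
    rwa [hPs.star_eq] at this
  have hdP : d * P = d := by rw [hd, sub_mul, mul_assoc, hPP, smul_mul_assoc, hPP]
  have hdN : d ∈ N := by
    refine sub_mem (mul_mem (mul_mem hPN a.2) hPN) ?_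
    rw [← Complex.coe_smul]
    exact SMulMemClass.smul_mem _ hPN
  have hy0 : 0 ≤ d⁺ := CFC.posPart_nonneg d
  have hys : IsSelfAdjoint d⁺ := .of_nonneg hy0
  have hyP : P * d⁺ = d⁺ := by
    have := congrArg star (posPart_mul_eq_self hds hP hdP)
    rwa [star_mul, hPs.star_eq, hys.star_eq] at this
  have hdval : ∀ ξ, P ξ = ξ → (⟪ξ, d ξ⟫_ℂ).re
      = (⟪ξ, (a : H →L[ℂ] H) ξ⟫_ℂ).re - (1 - ε) * ‖ξ‖ ^ 2 := by
    intro ξ hξ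
    have e : d ξ = P ((a : H →L[ℂ] H) (P ξ)) - (1 - ε) • P ξ := rfl
    rw [e, inner_sub_right, ← hPs.inner_apply_left, hξ, inner_smul_right_eq_smul,
      Complex.real_smul, Complex.sub_re, Complex.re_ofReal_mul, inner_self_eq_norm_sq_to_K]
    norm_cast
  refine ⟨M, hM, d⁺, posPart_mem hdN, hys, fun hz => ?_, hyP, fun ξ => ?_⟩
  · have hle : d ≤ 0 := by
      have h := CFC.posPart_sub_negPart d hds
      rw [hz, zero_sub] at h
      rw [← h]
      exact neg_nonpos.2 (CFC.negPart_nonneg d)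
    have := re_inner_le_of_le hle ζ
    rw [hdval ζ hζ] at this
    simp only [zero_apply, inner_zero_right, Complex.zero_re] at this
    linarith
  · have h2 := hdval (d⁺ ξ) (DFunLike.congr_fun hyP ξ)
    have h3 : d * d⁺ = d⁺ * d⁺ := by
      have := congrArg star (posPart_mul_self hds)
      rwa [star_mul, star_mul, hds.star_eq, hys.star_eq] at this
    have h4 : d (d⁺ ξ) = d⁺ (d⁺ ξ) := DFunLike.congr_fun h3 ξ
    have h5 := re_inner_le_of_le hy0 (d⁺ ξ)
    simp only [zero_apply, inner_zero_right, Complex.zero_re] at h5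
    rw [h4] at h2
    linarith

end IsPartition

/-- The supremum of the projections of a family whose index belongs to `S`. -/
noncomputable def subsetSup (p : ℕ → H →L[ℂ] H) (S : Set ℕ) : H →L[ℂ] H :=
  rangeSup fun n : S => p n

theorem isStarProjection_subsetSup (p : ℕ → H →L[ℂ] H) (S : Set ℕ) :
    IsStarProjection (subsetSup p S) :=
  isStarProjection_rangeSup _

namespace IsPartition

variable {N : VonNeumannAlgebra H} {p : ℕ → H →L[ℂ] H}

theorem subsetSup_mem (hp : IsPartition N p) (S : Set ℕ) : subsetSup p S ∈ N :=
  rangeSup_mem fun n => hp.mem n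

theorem _root_.subsetSup_mul_sum {p : ℕ → H →L[ℂ] H} {S : Set ℕ} {F : Finset ℕ} (h : ∀ n ∈ F, n ∈ S) :
    subsetSup p S * ∑ k ∈ F, p k = ∑ k ∈ F, p k := by
  rw [Finset.mul_sum]
  exact Finset.sum_congr rfl fun n hn => rangeSup_mul (fun n : S => p n) ⟨n, h n hn⟩

theorem subsetSup_mul_sum_eq_zero (hp : IsPartition N p) {S : Set ℕ} {F : Finset ℕ}
    (h : ∀ n ∈ F, n ∉ S) : subsetSup p S * ∑ k ∈ F, p k = 0 := by
  rw [Finset.mul_sum]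
  refine Finset.sum_eq_zero fun n hn => ?_
  have h1 : p n * subsetSup p S = 0 :=
    mul_rangeSup_eq_zero fun k => hp.orth n k fun e => h n hn (e ▸ k.2)
  have := congrArg star h1
  rwa [star_mul, (hp.proj n).isSelfAdjoint.star_eq,
    (isStarProjection_subsetSup p S).isSelfAdjoint.star_eq, star_zero] at this

theorem sum_mul_sum_eq_zero (hp : IsPartition N p) {F G : Finset ℕ} (h : Disjoint F G) :
    (∑ k ∈ F, p k) * ∑ k ∈ G, p k = 0 := by
  rw [Finset.sum_mul]
  refine Finset.sum_eq_zero fun m hm => ?_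
  rw [Finset.mul_sum]
  exact Finset.sum_eq_zero fun n hn => hp.orth m n (Finset.disjoint_iff_ne.1 h m hm n hn)

end IsPartition

/-- A sequence of nonzero self-adjoint elements of `N` with orthogonal ranges, on which the
effect `a` is asymptotically the identity. -/
structure IsAsymptoticSeq (N : VonNeumannAlgebra H) (a : H →L[ℂ] H) (y : ℕ → H →L[ℂ] H) :
    Prop where
  mem : ∀ k, y k ∈ N
  selfAdjoint : ∀ k, IsSelfAdjoint (y k)
  ne_zero : ∀ k, y k ≠ 0
  orth : ∀ j k, j ≠ k → y j * y k = 0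
  le_inner : ∀ (k : ℕ) (ξ : H), (1 - 1 / ((k : ℝ) + 1)) * ‖y k ξ‖ ^ 2 ≤ (⟪y k ξ, a (y k ξ)⟫_ℂ).re

theorem IsAsymptoticSeq.comp {N : VonNeumannAlgebra H} {a : H →L[ℂ] H} {y : ℕ → H →L[ℂ] H}
    (hy : IsAsymptoticSeq N a y) {g : ℕ → ℕ} (hg : StrictMono g) :
    IsAsymptoticSeq N a fun k => y (g k) where
  mem k := hy.mem _
  selfAdjoint k := hy.selfAdjoint _
  ne_zero k := hy.ne_zero _
  orth j k hjk := hy.orth _ _ (hg.injective.ne hjk)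
  le_inner k ξ := by
    refine le_trans ?_ (hy.le_inner (g k) ξ)
    have : k ≤ g k := hg.le_apply
    gcongr

/-- If a state with `f a = 1` kills all members of a partition, then a suitable subset of the
partition splits the behaviour of `a` at infinity. -/
theorem IsPartition.exists_split {N : VonNeumannAlgebra H} {p : ℕ → H →L[ℂ] H}
    (hp : IsPartition N p) {a : ↥N} {f : ↥N →ₗ[ℂ] ℂ} (hf : IsStateOn N f) (ha : IsEffect a)
    (hfa : f a = 1) (hfp : ∀ n, f ⟨p n, hp.mem n⟩ = 0) :
    ∃ (S : Set ℕ) (u v : ℕ → H →L[ℂ] H), IsAsymptoticSeq N a u ∧ IsAsymptoticSeq N a v ∧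
      (∀ k, subsetSup p S * u k = u k) ∧ ∀ k, subsetSup p S * v k = 0 := by
  have hε0 : ∀ k : ℕ, 0 < 1 / ((k : ℝ) + 1) := fun k => by positivity
  have hε1 : ∀ k : ℕ, 1 / ((k : ℝ) + 1) ≤ 1 := fun k => by
    rw [div_le_one (by positivity)]
    linarith [(Nat.cast_nonneg k : (0 : ℝ) ≤ k)]
  choose M hM y hyN hys hy0 hyP hya using fun m k : ℕ =>
    hp.exists_block hf ha hfa hfp m (hε0 k) (hε1 k)
  let t : ℕ → ℕ := fun k => Nat.rec 0 (fun k m => M m k) k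
  have ht : ∀ k, t (k + 1) = M (t k) k := fun k => rfl
  have hmono : Monotone t := monotone_nat_of_le_succ fun k => by rw [ht]; exact hM _ _
  have hinj : ∀ j k n, n ∈ Finset.Ico (t j) (t (j + 1)) → n ∈ Finset.Ico (t k) (t (k + 1)) →
      j = k := by
    intro j k n hj hk
    rw [Finset.mem_Ico] at hj hk
    by_contra hne
    rcases lt_or_gt_of_ne hne with h | h
    · have := hmono (show j + 1 ≤ k from h)
      omega
    · have := hmono (show k + 1 ≤ j from h)
      omega
  let z : ℕ → H →L[ℂ] H := fun k => y (t k) k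
  have hzP : ∀ k, (∑ n ∈ Finset.Ico (t k) (t (k + 1)), p n) * z k = z k := fun k => hyP (t k) k
  have hz : IsAsymptoticSeq N a z :=
    { mem := fun k => hyN _ _
      selfAdjoint := fun k => hys _ _
      ne_zero := fun k => hy0 _ _
      orth := fun j k hjk => by
        have h1 : z j * (∑ n ∈ Finset.Ico (t j) (t (j + 1)), p n) = z j := by
          have := congrArg star (hzP j)
          rwa [star_mul, (hp.isStarProjection_sum _).isSelfAdjoint.star_eq,
            (show IsSelfAdjoint (z j) from hys _ _).star_eq] at this
        rw [← h1, ← hzP k, mul_assoc, ← mul_assoc _ _ (z k), hp.sum_mul_sum_eq_zero, zero_mul,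
          mul_zero]
        exact Finset.disjoint_left.2 fun n hj hk => hjk (hinj j k n hj hk)
      le_inner := fun k ξ => hya (t k) k ξ }
  let S : Set ℕ := {n | ∃ k, n ∈ Finset.Ico (t (2 * k)) (t (2 * k + 1))}
  refine ⟨S, fun k => z (2 * k), fun k => z (2 * k + 1),
    hz.comp (g := fun k => 2 * k) (fun i j h => by dsimp only; omega),
    hz.comp (g := fun k => 2 * k + 1) (fun i j h => by dsimp only; omega), fun k => ?_, fun k => ?_⟩
  · change subsetSup p S * z (2 * k) = z (2 * k)
    rw [← hzP (2 * k), ← mul_assoc, subsetSup_mul_sum]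
    exact fun n hn => ⟨k, hn⟩
  · change subsetSup p S * z (2 * k + 1) = 0
    rw [← hzP (2 * k + 1), ← mul_assoc, hp.subsetSup_mul_sum_eq_zero, zero_mul]
    rintro n hn ⟨j, hj⟩
    have := hinj (2 * k + 1) (2 * j) n hn hj
    omega

theorem re_inner_effectAvg {N : VonNeumannAlgebra H} (a b : ↥N) (η : H) :
    (⟪η, (effectAvg a b : H →L[ℂ] H) η⟫_ℂ).re
      = ((⟪η, (a : H →L[ℂ] H) η⟫_ℂ).re + (⟪η, (b : H →L[ℂ] H) η⟫_ℂ).re) / 2 := by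
  rw [coe_effectAvg, smul_apply, add_apply, inner_smul_right_eq_smul, Complex.real_smul,
    Complex.re_ofReal_mul, inner_add_right, Complex.add_re]
  ring

theorem re_inner_self_eq {E : Type*} [NormedAddCommGroup E] [InnerProductSpace ℂ E] (η : E) : (⟪η, η⟫_ℂ).re = ‖η‖ ^ 2 := by
  rw [inner_self_eq_norm_sq_to_K]
  norm_cast

/-- If `b` fixes vectors which are almost fixed by `a`, some state takes the value `1` on the
average of `a` and `b`. -/
theorem exists_isStateOn_effectAvg {N : VonNeumannAlgebra H} {a b : ↥N} (ha : IsEffect a)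
    (hb : IsEffect b) {c : ℝ} (h : ∀ k : ℕ, ∃ η : H, η ≠ 0 ∧ (b : H →L[ℂ] H) η = η ∧
      (1 - c * (1 / ((k : ℝ) + 1))) * ‖η‖ ^ 2 ≤ (⟪η, (a : H →L[ℂ] H) η⟫_ℂ).re) :
    ∃ f, IsStateOn N f ∧ f (effectAvg a b) = 1 := by
  refine exists_isStateOn_eq_one (ha.effectAvg hb).2 fun δ hδ => ?_
  have ht : Tendsto (fun k : ℕ => c * (1 / ((k : ℝ) + 1))) atTop (𝓝 0) := by
    simpa using (tendsto_one_div_add_atTop_nhds_zero_nat (𝕜 := ℝ)).const_mul c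
  obtain ⟨k, hk⟩ := (ht.eventually_lt_const hδ).exists
  obtain ⟨η, h0, hbη, haη⟩ := h k
  refine ⟨η, h0, ?_⟩
  rw [re_inner_effectAvg, hbη, re_inner_self_eq]
  have : 0 < ‖η‖ ^ 2 := by positivity
  nlinarith

theorem IsAsymptoticSeq.exists_isStateOn {N : VonNeumannAlgebra H} {a b : ↥N} (ha : IsEffect a)
    (hb : IsEffect b) {y : ℕ → H →L[ℂ] H} (hy : IsAsymptoticSeq N a y)
    (h : ∀ k, (b : H →L[ℂ] H) * y k = y k) :
    ∃ f, IsStateOn N f ∧ f (effectAvg a b) = 1 := by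
  refine exists_isStateOn_effectAvg ha hb (c := 1) fun k => ?_
  obtain ⟨ξ, hξ⟩ : ∃ ξ, y k ξ ≠ 0 := by
    by_contra! hcon
    exact hy.ne_zero k (ContinuousLinearMap.ext hcon)
  refine ⟨y k ξ, hξ, DFunLike.congr_fun (h k) ξ, ?_⟩
  rw [one_mul]
  exact hy.le_inner k ξ

theorem re_inner_add_le {b : H →L[ℂ] H} (hb : 0 ≤ b) (α β : H) :
    (⟪α + β, b (α + β)⟫_ℂ).re ≤ 2 * ((⟪α, b α⟫_ℂ).re + (⟪β, b β⟫_ℂ).re) := by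
  have h := re_inner_le_of_le hb (α - β)
  simp only [zero_apply, inner_zero_right, Complex.zero_re, map_sub, inner_sub_left,
    inner_sub_right, Complex.sub_re] at h
  simp only [map_add, inner_add_left, inner_add_right, Complex.add_re]
  linarith

theorem sqrt_star_mul_self_mul_eq_zero {x t : H →L[ℂ] H} (h : x * t = 0) :
    CFC.sqrt (star x * x) * t = 0 := by
  refine eq_zero_of_star_mul_self ?_
  rw [star_mul, (IsSelfAdjoint.of_nonneg (CFC.sqrt_nonneg (star x * x))).star_eq, mul_assoc,
    ← mul_assoc (CFC.sqrt _), CFC.sqrt_mul_sqrt_self _ (star_mul_self_nonneg x), mul_assoc, h,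
    mul_zero, mul_zero]

/-- In a factor, given two sequences asymptotically fixed by `a` which are separated by a
projection `q`, there is an effect below `a` forcing states to take the value `1 / 2` at `q`. -/
theorem IsFactor.exists_half {N : VonNeumannAlgebra H} (hN : IsFactor N) {a : ↥N}
    (ha : IsEffect a) {q : H →L[ℂ] H} (hqN : q ∈ N) (hq : IsStarProjection q)
    {u v : ℕ → H →L[ℂ] H} (hu : IsAsymptoticSeq N a u) (hv : IsAsymptoticSeq N a v)
    (hqu : ∀ k, q * u k = u k) (hqv : ∀ k, q * v k = 0) :
    ∃ b : ↥N, IsEffect b ∧ (∃ f, IsStateOn N f ∧ f b = 1) ∧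
      ∀ f, IsStateOn N f → f b = 1 → f a = 1 ∧ f ⟨q, hqN⟩ = 1 / 2 := by
  choose z hzN hz using fun k =>
    hN.exists_mul_mul_ne_zero (hu.mem k) (hv.ne_zero k) (hu.ne_zero k)
  set x : ℕ → H →L[ℂ] H := fun k => v k * z k * u k with hx
  set h : ℕ → H →L[ℂ] H := fun k => CFC.sqrt (star (x k) * x k) with hh
  have hqs := hq.isSelfAdjoint.star_eq
  have hus : ∀ k, star (u k) = u k := fun k => (hu.selfAdjoint k).star_eq
  have hvs : ∀ k, star (v k) = v k := fun k => (hv.selfAdjoint k).star_eq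
  have hhs : ∀ k, star (h k) = h k := fun k =>
    (IsSelfAdjoint.of_nonneg (CFC.sqrt_nonneg (star (x k) * x k))).star_eq
  have hhh : ∀ k, h k * h k = star (x k) * x k := fun k =>
    CFC.sqrt_mul_sqrt_self _ (star_mul_self_nonneg (x k))
  have hxN : ∀ k, x k ∈ N := fun k => mul_mem (mul_mem (hv.mem k) (hzN k)) (hu.mem k)
  have hhN : ∀ k, h k ∈ N := fun k => sqrt_mem (mul_mem (star_mem (hxN k)) (hxN k))
  have hqx : ∀ k, q * x k = 0 := fun k => by
    simp only [hx]
    rw [mul_assoc, ← mul_assoc q, hqv, zero_mul]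
  have hxq : ∀ k, star (x k) * q = 0 := fun k => by
    have := congrArg star (hqx k)
    rwa [star_mul, hqs, star_zero] at this
  have huq : ∀ k, u k * q = u k := fun k => by
    have := congrArg star (hqu k)
    rwa [star_mul, hqs, hus] at this
  have hhq : ∀ k, h k * q = h k := fun k => by
    have h1 : x k * (1 - q) = 0 := by
      simp only [hx]
      rw [mul_sub, mul_one, mul_assoc _ _ q, huq, sub_self]
    have h2 : h k * (1 - q) = 0 := sqrt_star_mul_self_mul_eq_zero h1
    rw [mul_sub, mul_one, sub_eq_zero] at h2
    exact h2.symm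
  have hqh : ∀ k, q * h k = h k := fun k => by
    have := congrArg star (hhq k)
    rwa [star_mul, hqs, hhs] at this
  have hxx : ∀ j k, j ≠ k → star (x j) * x k = 0 := fun j k hjk => by
    simp only [hx, star_mul, hvs, hus, mul_assoc]
    rw [← mul_assoc (v j) (v k), hv.orth j k hjk]
    simp
  have hxx' : ∀ j k, j ≠ k → x j * star (x k) = 0 := fun j k hjk => by
    simp only [hx, star_mul, hvs, hus, mul_assoc]
    rw [← mul_assoc (u j) (u k), hu.orth j k hjk]
    simp
  have hhh' : ∀ j k, j ≠ k → h j * h k = 0 := fun j k hjk => by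
    have h1 : h k * star (x j) = 0 := sqrt_star_mul_self_mul_eq_zero (hxx' k j hjk.symm)
    have h2 : x j * h k = 0 := by
      have := congrArg star h1
      rwa [star_mul, star_star, hhs, star_zero] at this
    exact sqrt_star_mul_self_mul_eq_zero h2
  have hhx : ∀ j k, h j * x k = 0 := fun j k => by
    rw [← hhq, mul_assoc, hqx, mul_zero]
  have hxh : ∀ j k, star (x j) * h k = 0 := fun j k => by
    rw [← hqh, ← mul_assoc, hxq, zero_mul]
  set w : ℕ → H →L[ℂ] H := fun k => h k + x k with hw
  set U : H →L[ℂ] H := q + q - 1 with hU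
  have hUs : star U = U := by simp [hU, hqs]
  have hwU : ∀ j k, star (w j) * U * w k = 0 := by
    intro j k
    have h1 : U * w k = h k - x k := by
      simp only [hU, hw, mul_add, sub_mul, add_mul, hqh, hqx, one_mul]
      abel
    rw [mul_assoc, h1]
    simp only [hw, star_add, hhs, add_mul, mul_sub, hhx, hxh]
    by_cases hjk : j = k
    · rw [hjk, hhh]
      abel
    · rw [hhh' j k hjk, hxx j k hjk]
      abel
  have hrN : rangeSup w ∈ N := rangeSup_mem fun k => add_mem (hhN k) (hxN k)
  have hr := isStarProjection_rangeSup w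
  set r := rangeSup w with hrdef
  have hrUr : r * U * r = 0 := by
    refine mul_rangeSup_eq_zero fun k => ?_
    have h1 : star (w k) * U * r = 0 := mul_rangeSup_eq_zero fun j => hwU k j
    have := congrArg star h1
    rwa [star_mul, star_mul, star_star, hUs, hr.isSelfAdjoint.star_eq, star_zero,
      ← mul_assoc] at this
  have hre : IsEffect (⟨r, hrN⟩ : ↥N) := hr.isEffect hrN
  refine ⟨effectAvg a ⟨r, hrN⟩, ha.effectAvg hre, ?_, fun f hf hfb => ?_⟩
  · refine exists_isStateOn_effectAvg ha hre (c := 2) fun k => ?_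
    have hx0 : star (x k) * x k ≠ 0 := fun h0 => hz k (eq_zero_of_star_mul_self h0)
    obtain ⟨ζ, hζ⟩ : ∃ ζ, (star (x k) * x k) ζ ≠ 0 := by
      by_contra! hcon
      exact hx0 (ContinuousLinearMap.ext hcon)
    set α := (star (x k) * x k) ζ with hα
    set β := (x k * h k) ζ with hβ
    have hη : w k (h k ζ) = α + β := by
      rw [hα, ← hhh]
      rfl
    have hqα : q α = α := by
      have : q * (star (x k) * x k) = star (x k) * x k := by
        rw [← hhh, ← mul_assoc, hqh]
      exact DFunLike.congr_fun this ζ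
    have hqβ : q β = 0 := by
      have : q * (x k * h k) = 0 := by rw [← mul_assoc, hqx, zero_mul]
      exact DFunLike.congr_fun this ζ
    have hαβ : ⟪α, β⟫_ℂ = 0 := by
      rw [← hqα, hq.isSelfAdjoint.inner_apply_left, hqβ, inner_zero_right]
    have hnorm : ‖α + β‖ ^ 2 = ‖α‖ ^ 2 + ‖β‖ ^ 2 := by
      have := norm_add_sq_eq_norm_sq_add_norm_sq_of_inner_eq_zero α β hαβ
      simpa [sq] using this
    have hαu : α = u k ((star (z k) * v k * x k) ζ) := by
      have : star (x k) * x k = u k * (star (z k) * v k * x k) := by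
        conv_lhs => rw [hx]
        simp only [star_mul, hvs, hus, mul_assoc, hx]
      rw [hα, this]
      rfl
    have hβv : β = v k ((z k * u k * h k) ζ) := by
      have : x k * h k = v k * (z k * u k * h k) := by
        simp only [hx, mul_assoc]
      rw [hβ, this]
      rfl
    have hA := hu.le_inner k ((star (z k) * v k * x k) ζ)
    have hB := hv.le_inner k ((z k * u k * h k) ζ)
    rw [← hαu] at hA
    rw [← hβv] at hB
    refine ⟨α + β, fun h0 => hζ ?_, ?_, ?_⟩
    · have := congrArg q h0
      rwa [map_add, hqα, hqβ, add_zero, map_zero] at this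
    · rw [← hη]
      exact DFunLike.congr_fun (rangeSup_mul w k) (h k ζ)
    · have hsub := re_inner_add_le (sub_nonneg.2 ha.2) α β
      simp only [sub_apply, one_apply_eq_self, inner_sub_right, Complex.sub_re,
        re_inner_self_eq, hnorm] at hsub
      rw [hnorm]
      generalize 1 / ((k : ℝ) + 1) = e at hA hB ⊢
      linarith
  · obtain ⟨hfa, hfr⟩ := hf.effectAvg_eq_one ha hre hfb
    refine ⟨hfa, ?_⟩
    have h1 : f (⟨r, hrN⟩ * (⟨q, hqN⟩ + ⟨q, hqN⟩ - 1) * ⟨r, hrN⟩) = 0 := by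
      rw [← map_zero f]
      congr 1
      exact Subtype.ext hrUr
    rw [hf.map_mul_right hre.1 hre.2 hfr, hf.map_mul_left hre.1 hre.2 hfr, map_sub, map_add,
      hf.2] at h1
    linear_combination h1 / 2

theorem IsEffect.one_sub {N : VonNeumannAlgebra H} {a : ↥N} (ha : IsEffect a) :
    IsEffect (1 - a) :=
  ⟨sub_nonneg.2 ha.2, sub_le_self _ ha.1⟩

/-- The splitting property: if a state with `f a = 1` kills a partition, there are two
incompatible effects below `a`. -/
theorem IsPartition.exists_incompatible {N : VonNeumannAlgebra H} {p : ℕ → H →L[ℂ] H}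
    (hp : IsPartition N p) {a : ↥N} {f : ↥N →ₗ[ℂ] ℂ} (hf : IsStateOn N f) (ha : IsEffect a)
    (hfa : f a = 1) (hfp : ∀ n, f ⟨p n, hp.mem n⟩ = 0) :
    ∃ b c : ↥N, IsEffect b ∧ IsEffect c ∧ (∃ f, IsStateOn N f ∧ f b = 1) ∧
      (∃ f, IsStateOn N f ∧ f c = 1) ∧ (∀ f, IsStateOn N f → f b = 1 → f a = 1 ∧ f c ≠ 1) ∧
      ∀ f, IsStateOn N f → f c = 1 → f a = 1 := by
  obtain ⟨S, u, v, hu, hv, hqu, hqv⟩ := hp.exists_split hf ha hfa hfp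
  obtain ⟨q, hqdef⟩ : ∃ q : ↥N, q = ⟨subsetSup p S, hp.subsetSup_mem S⟩ := ⟨_, rfl⟩
  have hqe : IsEffect q := hqdef ▸ (isStarProjection_subsetSup p S).isEffect (hp.subsetSup_mem S)
  have hqu' : ∀ k, (q : H →L[ℂ] H) * u k = u k := by rw [hqdef]; exact hqu
  have hqv' : ∀ k, ((1 - q : ↥N) : H →L[ℂ] H) * v k = v k := fun k => by
    rw [hqdef]
    change (1 - subsetSup p S) * v k = v k
    rw [sub_mul, one_mul, hqv, sub_zero]
  have hb := hu.exists_isStateOn ha hqe hqu'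
  have hc := hv.exists_isStateOn ha hqe.one_sub hqv'
  refine ⟨effectAvg a q, effectAvg a (1 - q), ha.effectAvg hqe, ha.effectAvg hqe.one_sub, hb, hc,
    ?_, ?_⟩
  · intro g hg hgb
    have h1 := hg.effectAvg_eq_one ha hqe hgb
    refine ⟨h1.1, fun hgc => ?_⟩
    have h2 := (hg.effectAvg_eq_one ha hqe.one_sub hgc).2
    rw [map_sub, hg.2, h1.2] at h2
    norm_num at h2
  · exact fun g hg hgc => (hg.effectAvg_eq_one ha hqe.one_sub hgc).1

/-- Every effect can be refined so that its states are not multiplicative and null on a given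
partition. -/
theorem IsPartition.exists_refinement {N : VonNeumannAlgebra H} (hN : IsFactor N)
    {p : ℕ → H →L[ℂ] H} (hp : IsPartition N p) {a : ↥N} (ha : IsEffect a)
    (hex : ∃ f, IsStateOn N f ∧ f a = 1) :
    ∃ b : ↥N, IsEffect b ∧ (∃ f, IsStateOn N f ∧ f b = 1) ∧
      ∀ f, IsStateOn N f → f b = 1 → f a = 1 ∧
        ((∃ n, f ⟨p n, hp.mem n⟩ ≠ 0) ∨ ∃ S, f ⟨subsetSup p S, hp.subsetSup_mem S⟩ = 1 / 2) := by
  by_cases h : ∃ f, IsStateOn N f ∧ f a = 1 ∧ ∀ n, f ⟨p n, hp.mem n⟩ = 0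
  · obtain ⟨f, hf, hfa, hfp⟩ := h
    obtain ⟨S, u, v, hu, hv, hqu, hqv⟩ := hp.exists_split hf ha hfa hfp
    obtain ⟨b, hb, hex, hval⟩ := hN.exists_half ha (hp.subsetSup_mem S)
      (isStarProjection_subsetSup p S) hu hv hqu hqv
    exact ⟨b, hb, hex, fun g hg hgb => ⟨(hval g hg hgb).1, Or.inr ⟨S, (hval g hg hgb).2⟩⟩⟩
  · push Not at h
    exact ⟨a, ha, hex, fun g hg hga => ⟨hga, Or.inl (h g hg hga)⟩⟩

theorem continuous_inner_sigmaWeak (ξ : H) :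
    @Continuous (H →L[ℂ] H) ℂ (sigmaWeak H) _ fun x => ⟪ξ, x ξ⟫_ℂ := by
  rw [continuous_iff_le_induced, sigmaWeak]
  have hs : Summable fun n => ‖Pi.single (M := fun _ : ℕ => H) 0 ξ n‖ ^ 2 :=
    summable_of_ne_finset_zero (s := {0}) fun n hn => by
      rw [Pi.single_eq_of_ne (by simpa using hn)]
      simp
  refine iInf_le_of_le (Pi.single 0 ξ) (iInf_le_of_le (Pi.single 0 ξ)
    (iInf_le_of_le hs (iInf_le_of_le hs (le_of_eq ?_))))
  congr 1
  funext x
  rw [tsum_eq_single 0 fun n hn => by rw [Pi.single_eq_of_ne hn]; simp, Pi.single_eq_same]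

theorem tendsto_sigmaWeak {e : ℕ → H →L[ℂ] H} {x : H →L[ℂ] H} (hb : ∀ M ξ, ‖e M ξ‖ ≤ ‖ξ‖)
    (h : ∀ ξ, Tendsto (fun M => e M ξ) atTop (𝓝 (x ξ))) :
    Tendsto e atTop (@nhds _ (sigmaWeak H) x) := by
  unfold sigmaWeak
  rw [nhds_iInf, tendsto_iInf]
  intro ξ
  rw [nhds_iInf, tendsto_iInf]
  intro η
  rw [nhds_iInf, tendsto_iInf]
  intro hξ
  rw [nhds_iInf, tendsto_iInf]
  intro hη
  rw [nhds_induced, tendsto_comap_iff]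
  refine tendsto_tsum_of_dominated_convergence (bound := fun n => ‖ξ n‖ * ‖η n‖) ?_ ?_ ?_
  · refine Summable.of_nonneg_of_le (fun n => by positivity) (fun n => ?_) (hξ.add hη)
    nlinarith [sq_nonneg (‖ξ n‖ - ‖η n‖), sq_nonneg (‖ξ n‖), sq_nonneg (‖η n‖)]
  · exact fun n => tendsto_const_nhds.inner (h (η n))
  · exact Eventually.of_forall fun M n =>
      (norm_inner_le_norm _ _).trans (mul_le_mul_of_nonneg_left (hb _ _) (norm_nonneg _))

theorem IsPartition.isSingularOn {N : VonNeumannAlgebra H} {p : ℕ → H →L[ℂ] H}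
    (hp : IsPartition N p) {f : ↥N →ₗ[ℂ] ℂ} (hf : IsPureStateOn N f)
    (hfp : ∀ n, f ⟨p n, hp.mem n⟩ = 0) : IsSingularOn N f := by
  intro g hg hfg hgn
  obtain ⟨t, -, rfl⟩ := hf.2 g hg hfg
  refine hg.eq_zero_of_map_one ?_
  set g := (t : ℂ) • f
  let e : ℕ → ↥N := fun M => ∑ k ∈ Finset.range M, ⟨p k, hp.mem k⟩
  have he : ∀ M, (e M : H →L[ℂ] H) = ∑ k ∈ Finset.range M, p k := fun M => by
    simp only [e, AddSubmonoidClass.coe_finsetSum]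
  have hge : ∀ M, g (e M) = 0 := fun M => by
    simp only [e, g, map_sum, LinearMap.smul_apply, hfp, smul_zero, Finset.sum_const_zero]
  have ht : Tendsto (fun M => (e M : H →L[ℂ] H)) atTop
      (@nhds _ (sigmaWeak H) ((1 : ↥N) : H →L[ℂ] H)) := by
    refine tendsto_sigmaWeak (fun M ξ => ?_) fun ξ => ?_
    · rw [he]
      exact (hp.isStarProjection_sum _).norm_apply_le ξ
    · simp only [he]
      exact hp.tendsto_sum ξ
  let : TopologicalSpace (H →L[ℂ] H) := sigmaWeak H
  let : TopologicalSpace ↥N :=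
    TopologicalSpace.induced (fun x : ↥N => (x : H →L[ℂ] H)) (sigmaWeak H)
  have ht' : Tendsto e atTop (𝓝 1) := by
    rw [nhds_induced, tendsto_comap_iff]
    exact ht
  have hgt : Tendsto (fun M => g (e M)) atTop (𝓝 (g 1)) :=
    ((show Continuous g from hgn).tendsto 1).comp ht'
  simp only [hge] at hgt
  exact tendsto_nhds_unique hgt tendsto_const_nhds

theorem countable_of_pairwise_orthogonal [TopologicalSpace.SeparableSpace H]
    {T : Set (H →L[ℂ] H)} (hT : ∀ e ∈ T, IsStarProjection e ∧ e ≠ 0)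
    (horth : T.Pairwise fun e e' => e * e' = 0) : T.Countable := by
  have hex : ∀ e ∈ T, ∃ ξ : H, ‖ξ‖ = 1 ∧ e ξ = ξ := by
    intro e he
    obtain ⟨ζ, hζ⟩ : ∃ ζ, e ζ ≠ 0 := by
      by_contra! hcon
      exact (hT e he).2 (ContinuousLinearMap.ext hcon)
    refine ⟨(‖e ζ‖⁻¹ : ℂ) • e ζ, ?_, ?_⟩
    · rw [norm_smul]
      simp [hζ]
    · have : e (e ζ) = e ζ := DFunLike.congr_fun (hT e he).1.isIdempotentElem.eq ζ
      rw [map_smul, this]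
  choose! ξ hξ hξe using hex
  refine Set.PairwiseDisjoint.countable_of_isOpen (s := fun e => Metric.ball (ξ e) (1 / 2)) ?_
    (fun e _ => Metric.isOpen_ball) fun e _ => ⟨ξ e, Metric.mem_ball_self (by norm_num)⟩
  intro e he e' he' hne
  refine Metric.ball_disjoint_ball ?_
  have hin : ⟪ξ e, ξ e'⟫_ℂ = 0 := by
    rw [← hξe e he, (hT e he).1.isSelfAdjoint.inner_apply_left, ← hξe e' he']
    have : e (e' (ξ e')) = 0 := DFunLike.congr_fun (horth he he' hne) (ξ e')
    rw [this, inner_zero_right]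
  have hd : dist (ξ e) (ξ e') * dist (ξ e) (ξ e') = 2 := by
    rw [dist_eq_norm, ← sq, @norm_sub_sq ℂ, hin, hξ e he, hξ e' he']
    norm_num
  nlinarith [dist_nonneg (x := ξ e) (y := ξ e')]

/-- A state taking, on each partition, a nonzero value at a member or the value `1 / 2` at some
partial supremum is classically normal. -/
theorem IsStateOn.isClassicallyNormalOn [TopologicalSpace.SeparableSpace H]
    {N : VonNeumannAlgebra H} {f : ↥N →ₗ[ℂ] ℂ} (hf : IsStateOn N f)
    (hpart : ∀ (p : ℕ → H →L[ℂ] H) (hp : IsPartition N p), (∃ n, f ⟨p n, hp.mem n⟩ ≠ 0) ∨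
      ∃ S, f ⟨subsetSup p S, hp.subsetSup_mem S⟩ = 1 / 2) :
    IsClassicallyNormalOn N f := by
  intro C hC hmul
  have hidem : ∀ e (he : e ∈ C), IsStarProjection e → f ⟨e, hC he⟩ = 0 ∨ f ⟨e, hC he⟩ = 1 := by
    intro e he hep
    have h := hmul ⟨e, hC he⟩ ⟨e, hC he⟩ he he
    have h2 : (⟨e, hC he⟩ * ⟨e, hC he⟩ : ↥N) = ⟨e, hC he⟩ :=
      Subtype.ext hep.isIdempotentElem.eq
    rw [h2] at h
    rcases eq_or_ne (f ⟨e, hC he⟩) 0 with h0 | h0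
    · exact Or.inl h0
    · exact Or.inr (mul_left_cancel₀ h0 (by rw [← h, mul_one]))
  let Z : Set (H →L[ℂ] H) := {e | ∃ h : e ∈ C, IsStarProjection e ∧ e ≠ 0 ∧ f ⟨e, hC h⟩ = 0}
  obtain ⟨T, ⟨hTZ, hTorth⟩, hTmax⟩ := zorn_subset
    {T : Set (H →L[ℂ] H) | T ⊆ Z ∧ T.Pairwise fun e e' => e * e' = 0} (by
      intro c hc hchain
      refine ⟨⋃₀ c, ⟨Set.sUnion_subset fun s hs => (hc hs).1, ?_⟩,
        fun s hs => Set.subset_sUnion_of_mem hs⟩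
      exact (Set.pairwise_sUnion hchain.directedOn).2 fun s hs => (hc hs).2)
  have hTc : T.Countable := countable_of_pairwise_orthogonal
    (fun e he => by obtain ⟨-, h1, h2, -⟩ := hTZ he; exact ⟨h1, h2⟩) hTorth
  obtain ⟨g, hg⟩ := Set.countable_iff_exists_injective.1 hTc
  let p : ℕ → H →L[ℂ] H := Function.extend g (fun e : T => (e : H →L[ℂ] H)) 0
  have hpg : ∀ e : T, p (g e) = e := fun e => hg.extend_apply _ _ e
  have hp0 : ∀ n, (¬ ∃ e, g e = n) → p n = 0 := fun n hn => Function.extend_apply' _ _ _ hn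
  have hpC : ∀ n, p n ∈ C := fun n => by
    by_cases hn : ∃ e, g e = n
    · obtain ⟨e, rfl⟩ := hn
      rw [hpg]
      exact (hTZ e.2).1
    · rw [hp0 n hn]
      exact zero_mem C
  have hpp : ∀ n, IsStarProjection (p n) := fun n => by
    by_cases hn : ∃ e, g e = n
    · obtain ⟨e, rfl⟩ := hn
      rw [hpg]
      exact (hTZ e.2).2.1
    · rw [hp0 n hn]
      exact IsStarProjection.zero _
  have hpo : ∀ m n, m ≠ n → p m * p n = 0 := fun m n hmn => by
    by_cases hm : ∃ e, g e = m
    · by_cases hn : ∃ e, g e = n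
      · obtain ⟨e, rfl⟩ := hm
        obtain ⟨e', rfl⟩ := hn
        rw [hpg, hpg]
        exact hTorth e.2 e'.2 fun h => hmn (congrArg g (Subtype.ext h))
      · rw [hp0 n hn, mul_zero]
    · rw [hp0 m hm, zero_mul]
  have hfp : ∀ n (h : p n ∈ N), f ⟨p n, h⟩ = 0 := fun n h => by
    by_cases hn : ∃ e, g e = n
    · obtain ⟨e, rfl⟩ := hn
      have e1 : (⟨p (g e), h⟩ : ↥N) = ⟨e, hC (hTZ e.2).1⟩ := Subtype.ext (hpg e)
      rw [e1]
      exact (hTZ e.2).2.2.2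
    · have e1 : (⟨p n, h⟩ : ↥N) = 0 := Subtype.ext (hp0 n hn)
      rw [e1, map_zero]
  have hR := isStarProjection_rangeSup p
  have hRC : rangeSup p ∈ C := rangeSup_mem hpC
  set e₀ : H →L[ℂ] H := 1 - rangeSup p with he₀
  have heC : e₀ ∈ C := sub_mem (one_mem C) hRC
  have hep : IsStarProjection e₀ := hR.one_sub
  have heT : ∀ e ∈ T, e₀ * e = 0 := fun e he => by
    have := rangeSup_mul p (g ⟨e, he⟩)
    rw [hpg] at this
    rw [he₀, sub_mul, one_mul, this, sub_self]
  have hzero : ∀ q (hq : q ∈ C), IsStarProjection q → e₀ * q = q → f ⟨q, hC hq⟩ = 0 → q = 0 := by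
    intro q hqC hq hle hfq
    by_contra hq0
    have hqT : q ∉ T := fun h => hq0 (by rw [← hle, heT q h])
    have hqe : q * e₀ = q := by
      have := congrArg star hle
      rwa [star_mul, hq.isSelfAdjoint.star_eq, hep.isSelfAdjoint.star_eq] at this
    have h1 : ∀ e ∈ T, q * e = 0 := fun e he => by
      rw [← hqe, mul_assoc, heT e he, mul_zero]
    have h2 : ∀ e ∈ T, e * q = 0 := fun e he => by
      have := congrArg star (h1 e he)
      rwa [star_mul, hq.isSelfAdjoint.star_eq, (hTZ he).2.1.isSelfAdjoint.star_eq,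
        star_zero] at this
    have hins : insert q T ∈ {T : Set (H →L[ℂ] H) | T ⊆ Z ∧ T.Pairwise fun e e' => e * e' = 0} :=
      ⟨Set.insert_subset ⟨hqC, hq, hq0, hfq⟩ hTZ,
        hTorth.insert fun e he _ => ⟨h1 e he, h2 e he⟩⟩
    exact hqT (hTmax hins (Set.subset_insert q T) (Set.mem_insert q T))
  rcases hidem e₀ heC hep with h0 | h1
  · exfalso
    have hz := hzero e₀ heC hep hep.isIdempotentElem.eq h0
    have hpart' : IsPartition N p :=
      ⟨fun n => hC (hpC n), hpp, hpo, (sub_eq_zero.1 hz).symm⟩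
    rcases hpart p hpart' with ⟨n, hn⟩ | ⟨S, hS⟩
    · exact hn (hfp n _)
    · have hSC : subsetSup p S ∈ C := rangeSup_mem fun n => hpC n
      rcases hidem _ hSC (isStarProjection_subsetSup p S) with h | h <;>
        · rw [h] at hS
          norm_num at hS
  · clear_value e₀
    have hmin : ∀ q ∈ C, IsStarProjection q → e₀ * q = q → q = 0 ∨ q = e₀ := by
      intro q hqC hq hle
      rcases hidem q hqC hq with h | h
      · exact Or.inl (hzero q hqC hq hle h)
      · right
        have hqe : q * e₀ = q := by
          have := congrArg star hle
          rwa [star_mul, hq.isSelfAdjoint.star_eq, hep.isSelfAdjoint.star_eq] at this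
        have hd : IsStarProjection (e₀ - q) := by
          refine ⟨?_, hep.isSelfAdjoint.sub hq.isSelfAdjoint⟩
          change (e₀ - q) * (e₀ - q) = e₀ - q
          rw [mul_sub, sub_mul, sub_mul, hep.isIdempotentElem.eq, hqe, hle,
            hq.isIdempotentElem.eq, sub_self, sub_zero]
        have hdC : e₀ - q ∈ C := sub_mem heC hqC
        have hfd : f ⟨e₀ - q, hC hdC⟩ = 0 := by
          have e1 : (⟨e₀ - q, hC hdC⟩ : ↥N) = ⟨e₀, hC heC⟩ - ⟨q, hC hqC⟩ := rfl
          rw [e1, map_sub, h1, h, sub_self]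
        exact (sub_eq_zero.1 (hzero _ hdC hd (by
          rw [mul_sub, hep.isIdempotentElem.eq, hle]) hfd)).symm
    have he0 : e₀ ≠ 0 := fun h => by
      have e1 : (⟨e₀, hC heC⟩ : ↥N) = 0 := Subtype.ext h
      rw [e1, map_zero] at h1
      exact zero_ne_one h1
    obtain ⟨ζ, hζ⟩ : ∃ ζ, e₀ ζ ≠ 0 := by
      by_contra! hcon
      exact he0 (ContinuousLinearMap.ext hcon)
    obtain ⟨ξ, hξ, hξe⟩ : ∃ ξ : H, ⟪ξ, ξ⟫_ℂ = 1 ∧ e₀ ξ = ξ := by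
      refine ⟨(‖e₀ ζ‖⁻¹ : ℂ) • e₀ ζ, ?_, ?_⟩
      · have hn : ‖(‖e₀ ζ‖⁻¹ : ℂ) • e₀ ζ‖ = 1 := by
          rw [norm_smul]
          simp [hζ]
        rw [inner_self_eq_norm_sq_to_K, hn]
        simp
      · have : e₀ (e₀ ζ) = e₀ ζ := DFunLike.congr_fun hep.isIdempotentElem.eq ζ
        rw [map_smul, this]
    have hval : (fun x : ↥C => f ⟨x, hC x.2⟩) = fun x : ↥C => ⟪ξ, (x : H →L[ℂ] H) ξ⟫_ℂ := by
      funext x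
      obtain ⟨c, hc⟩ := exists_corner_eq_smul hep heC hmin x.2
      have h2 : f (⟨e₀, hC heC⟩ * ⟨x, hC x.2⟩ * ⟨e₀, hC heC⟩) = c := by
        have e1 : (⟨e₀, hC heC⟩ * ⟨x, hC x.2⟩ * ⟨e₀, hC heC⟩ : ↥N) = c • ⟨e₀, hC heC⟩ :=
          Subtype.ext hc
        rw [e1, map_smul, h1, smul_eq_mul, mul_one]
      rw [hf.map_mul_right hep.nonneg hep.le_one h1,
        hf.map_mul_left hep.nonneg hep.le_one h1] at h2
      have h3 : ⟪ξ, (x : H →L[ℂ] H) ξ⟫_ℂ = ⟪ξ, (e₀ * x * e₀) ξ⟫_ℂ := by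
        change _ = ⟪ξ, e₀ ((x : H →L[ℂ] H) (e₀ ξ))⟫_ℂ
        rw [← hep.isSelfAdjoint.inner_apply_left, hξe]
      rw [h2, h3, hc, smul_apply, hξe, inner_smul_right, hξ, mul_one]
    unfold IsNormalOnSub
    rw [hval]
    let : TopologicalSpace (H →L[ℂ] H) := sigmaWeak H
    exact (continuous_inner_sigmaWeak ξ).comp continuous_induced_dom

/-- Transfinite construction of a binary tree of decreasing branches in a preorder in which
countable chains are bounded below: the branches meet prescribed dense sets, and any two distinct
branches are separated by the splitting relation `R`. -/
theorem exists_branching_family {ι P : Type*} [LinearOrder ι] [WellFoundedLT ι] [Preorder P]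
    (hι : ∀ i : ι, (Set.Iio i).Countable)
    (hchain : ∀ s : Set P, s.Countable → IsChain (· ≤ ·) s → ∃ b, ∀ a ∈ s, b ≤ a)
    (D : ι → Set P) (hD : ∀ i a, ∃ b ∈ D i, b ≤ a)
    (R : P → P → Prop) (hR : ∀ a, ∃ b c, b ≤ a ∧ c ≤ a ∧ R b c) :
    ∃ F : (ι → Bool) → ι → P, (∀ σ i j, i ≤ j → F σ j ≤ F σ i) ∧
      (∀ σ i, ∃ b ∈ D i, F σ i ≤ b) ∧
      ∀ σ τ, σ ≠ τ → ∃ i, R (F σ i) (F τ i) ∨ R (F τ i) (F σ i) := by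
  obtain ⟨b₀, -⟩ := hchain ∅ Set.countable_empty (by simp [IsChain])
  have hchain' : ∀ s : Set P, ∃ b, s.Countable → IsChain (· ≤ ·) s → ∀ a ∈ s, b ≤ a := fun s => by
    by_cases h : s.Countable ∧ IsChain (· ≤ ·) s
    · obtain ⟨b, hb⟩ := hchain s h.1 h.2
      exact ⟨b, fun _ _ => hb⟩
    · exact ⟨b₀, fun h₁ h₂ => absurd ⟨h₁, h₂⟩ h⟩
  choose L hL using hchain'
  choose d hdD hdle using hD
  choose l r hl hr hlr using hR
  let G : (ι → Bool) → ∀ i : ι, (∀ j, j < i → P) → P := fun σ i rec =>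
    if σ i then l (d i (L {x | ∃ j h, rec j h = x})) else r (d i (L {x | ∃ j h, rec j h = x}))
  let F : (ι → Bool) → ι → P := fun σ => (wellFounded_lt (α := ι)).fix (G σ)
  have hF : ∀ σ i, F σ i = if σ i then l (d i (L (F σ '' Set.Iio i)))
      else r (d i (L (F σ '' Set.Iio i))) := fun σ i => by
    have h : {x | ∃ j, ∃ _ : j < i, F σ j = x} = F σ '' Set.Iio i := by
      ext x
      simp
    rw [← h]
    exact WellFounded.fix_eq _ _ _
  have hFd : ∀ σ i, F σ i ≤ d i (L (F σ '' Set.Iio i)) := fun σ i => by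
    rw [hF]
    split_ifs
    exacts [hl _, hr _]
  have hlt : ∀ σ i j, j < i → F σ i ≤ F σ j := by
    intro σ i
    induction i using WellFoundedLT.induction with
    | ind i ih =>
      intro j hj
      refine (hFd σ i).trans ((hdle _ _).trans (hL _ ((hι i).image _) ?_ _ ⟨j, hj, rfl⟩))
      rintro _ ⟨k, hk, rfl⟩ _ ⟨m, hm, rfl⟩ -
      rcases lt_trichotomy k m with h | rfl | h
      · exact Or.inr (ih m hm k h)
      · exact Or.inl le_rfl
      · exact Or.inl (ih k hk m h)
  refine ⟨F, fun σ i j hij => ?_, fun σ i => ⟨_, hdD i _, hFd σ i⟩, fun σ τ hστ => ?_⟩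
  · rcases hij.eq_or_lt with rfl | h
    exacts [le_rfl, hlt σ j i h]
  obtain ⟨i₁, hi₁⟩ := Function.ne_iff.1 hστ
  obtain ⟨i, hi, hmin⟩ := (wellFounded_lt (α := ι)).has_min {i | σ i ≠ τ i} ⟨i₁, hi₁⟩
  have hagree : ∀ j < i, σ j = τ j := fun j hj => by
    by_contra h
    exact hmin j h hj
  have heq : ∀ j, j < i → F σ j = F τ j := by
    intro j
    induction j using WellFoundedLT.induction with
    | ind j ih =>
      intro hj
      have h : F σ '' Set.Iio j = F τ '' Set.Iio j :=
        Set.image_congr fun k hk => ih k hk (lt_trans hk hj)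
      rw [hF, hF, hagree j hj, h]
  have himg : F σ '' Set.Iio i = F τ '' Set.Iio i := Set.image_congr heq
  refine ⟨i, ?_⟩
  rw [hF σ i, hF τ i, himg]
  have hi' : σ i ≠ τ i := hi
  cases hσ : σ i <;> cases hτ : τ i
  · exact absurd (hσ.trans hτ.symm) hi'
  · exact Or.inr (hlr _)
  · exact Or.inl (hlr _)
  · exact absurd (hσ.trans hτ.symm) hi'

theorem mk_le_continuum_of_separableSpace {X : Type*} [MetricSpace X]
    [TopologicalSpace.SeparableSpace X] : Cardinal.mk X ≤ Cardinal.continuum := by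
  rcases isEmpty_or_nonempty X with h | h
  · simp
  have hinj : Function.Injective
      fun (x : X) => {m : ℕ × ℕ | dist (TopologicalSpace.denseSeq X m.1) x < 1 / (m.2 + 1)} := by
    intro x y hxy
    by_contra hne
    obtain ⟨k, hk⟩ := exists_nat_one_div_lt (half_pos (dist_pos.2 hne))
    obtain ⟨n, hn⟩ := (TopologicalSpace.denseRange_denseSeq X).exists_dist_lt x
      (ε := 1 / ((k : ℝ) + 1)) (by positivity)
    have hx : (n, k) ∈ {m : ℕ × ℕ | dist (TopologicalSpace.denseSeq X m.1) x < 1 / (m.2 + 1)} := by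
      rw [Set.mem_ofPred_eq, dist_comm]
      exact hn
    have hy : (n, k) ∈ {m : ℕ × ℕ | dist (TopologicalSpace.denseSeq X m.1) y < 1 / (m.2 + 1)} :=
      (Set.ext_iff.1 hxy (n, k)).1 hx
    have h₁ : dist (TopologicalSpace.denseSeq X n) y < 1 / ((k : ℝ) + 1) := hy
    linarith [dist_triangle x (TopologicalSpace.denseSeq X n) y]
  simpa using Cardinal.lift_mk_le_lift_mk_of_injective hinj

theorem mk_nat_arrow_le_continuum {X : Type*} (hX : Cardinal.mk X ≤ Cardinal.continuum) :
    Cardinal.mk (ℕ → X) ≤ Cardinal.continuum := by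
  rw [Cardinal.mk_arrow]
  simpa using Cardinal.power_le_power_right (c := Cardinal.aleph0) hX

theorem mk_seq_continuousLinearMap_le {E : Type*} [NormedAddCommGroup E] [NormedSpace ℂ E]
    [TopologicalSpace.SeparableSpace E] :
    Cardinal.mk (ℕ → E →L[ℂ] E) ≤ Cardinal.continuum := by
  refine mk_nat_arrow_le_continuum ((Cardinal.mk_le_of_injective (f := fun (x : E →L[ℂ] E) n =>
    x (TopologicalSpace.denseSeq E n)) fun x y hxy => ?_).trans
      (mk_nat_arrow_le_continuum (X := E) mk_le_continuum_of_separableSpace))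
  exact DFunLike.coe_injective ((TopologicalSpace.denseRange_denseSeq E).equalizer x.continuous
    y.continuous hxy)

theorem exists_isPartition {N : VonNeumannAlgebra H} (hinf : ¬ FiniteDimensional ℂ ↥N) :
    ∃ p : ℕ → H →L[ℂ] H, IsPartition N p ∧ ∀ n, p (n + 1) ≠ 0 := by
  obtain ⟨q, hqN, hq, hqq, hq0⟩ := exists_orthogonal_projections hinf
  have hR := isStarProjection_rangeSup q
  let p : ℕ → H →L[ℂ] H := fun n => Nat.casesOn n (1 - rangeSup q) q
  have hp0 : p 0 = 1 - rangeSup q := rfl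
  have hps : ∀ n, p (n + 1) = q n := fun n => rfl
  have h0 : ∀ n, p 0 * p (n + 1) = 0 := fun n => by
    rw [hp0, hps, sub_mul, one_mul, rangeSup_mul, sub_self]
  have hproj : ∀ n, IsStarProjection (p n)
    | 0 => hR.one_sub
    | n + 1 => hq n
  refine ⟨p, ⟨?_, hproj, ?_, ?_⟩, hq0⟩
  · rintro (_ | n)
    exacts [sub_mem (one_mem _) (rangeSup_mem hqN), hqN n]
  · rintro (_ | m) (_ | n) h
    · exact absurd rfl h
    · exact h0 n
    · have := congrArg star (h0 m)
      rwa [star_mul, star_zero, (hproj 0).isSelfAdjoint.star_eq,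
        (hproj (m + 1)).isSelfAdjoint.star_eq] at this
    · exact hqq m n (by omega)
  · have ht : ∀ n, (1 - rangeSup p) * p n = 0 := fun n => by
      rw [sub_mul, one_mul, rangeSup_mul, sub_self]
    have hz := ht 0
    rw [hp0, mul_sub, mul_one, mul_rangeSup_eq_zero (fun n => ht (n + 1)), sub_zero] at hz
    exact (sub_eq_zero.1 hz).symm

/-- The set of states taking the value `1` at `b`. -/
def stateFace (N : VonNeumannAlgebra H) (b : ↥N) : Set (↥N →ₗ[ℂ] ℂ) :=
  {f | IsStateOn N f ∧ f b = 1}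

/-- A nonempty set of states cut out by an effect. -/
def IsStateFace (N : VonNeumannAlgebra H) (K : Set (↥N →ₗ[ℂ] ℂ)) : Prop :=
  K.Nonempty ∧ ∃ b, IsEffect b ∧ K = stateFace N b

theorem exists_isPureStateOn_forall_mem {N : VonNeumannAlgebra H} {ι : Type*} [Nonempty ι]
    {K : ι → Set (↥N →ₗ[ℂ] ℂ)} (b : ι → ↥N) (hb : ∀ i, IsEffect (b i))
    (hK : ∀ i, K i = stateFace N (b i))
    (hfin : ∀ s : Finset ι, ∃ f, IsStateOn N f ∧ ∀ i ∈ s, f ∈ K i) :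
    ∃ f, IsPureStateOn N f ∧ ∀ i, f ∈ K i := by
  classical
  obtain ⟨f, hf, hfb⟩ := exists_isPureStateOn (Set.range b) (by
    rintro _ ⟨i, rfl⟩
    exact (hb i).2) (fun s hs => by
    choose! i hi using hs
    obtain ⟨f, hf, hfs⟩ := hfin (s.image i)
    refine ⟨f, hf, fun a ha => ?_⟩
    have h := hfs _ (Finset.mem_image_of_mem i ha)
    rw [hK, hi ha] at h
    exact h.2)
  exact ⟨f, hf, fun i => by
    rw [hK]
    exact ⟨hf.1, hfb _ ⟨i, rfl⟩⟩⟩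

theorem exists_isPureStateOn_forall_mem_of_directed {N : VonNeumannAlgebra H} {ι : Type*}
    [Nonempty ι] {K : ι → Set (↥N →ₗ[ℂ] ℂ)} (hK : ∀ i, IsStateFace N (K i))
    (hdir : Directed (· ⊇ ·) K) : ∃ f, IsPureStateOn N f ∧ ∀ i, f ∈ K i := by
  choose hne b hb hKb using hK
  refine exists_isPureStateOn_forall_mem b hb hKb fun s => ?_
  obtain ⟨z, hz⟩ := hdir.finset_le s
  obtain ⟨f, hf⟩ := hne z
  exact ⟨f, (hKb z ▸ hf : f ∈ stateFace N (b z)).1, fun i hi => hz i hi hf⟩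

theorem isStateFace_iInter {N : VonNeumannAlgebra H} {K : ℕ → Set (↥N →ₗ[ℂ] ℂ)}
    (hK : ∀ k, IsStateFace N (K k)) {f : ↥N →ₗ[ℂ] ℂ} (hf : ∀ k, f ∈ K k) :
    IsStateFace N (⋂ k, K k) := by
  refine ⟨⟨f, Set.mem_iInter.2 hf⟩, ?_⟩
  choose hne b hb hKb using hK
  obtain ⟨c, hc, hcb⟩ := exists_effect_forall_eq_one b hb
  refine ⟨c, hc, Set.ext fun g => ?_⟩
  simp only [Set.mem_iInter, hKb]
  exact ⟨fun h => ⟨(h 0).1, (hcb g (h 0).1).2 fun k => (h k).2⟩,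
    fun h k => ⟨h.1, (hcb g h.1).1 h.2 k⟩⟩

theorem IsPartition.isStateFace {N : VonNeumannAlgebra H} {p : ℕ → H →L[ℂ] H}
    (hp : IsPartition N p) (hp0 : ∀ n, p (n + 1) ≠ 0) :
    IsStateFace N {f | IsStateOn N f ∧ ∀ n, f ⟨p n, hp.mem n⟩ = 0} := by
  let b : ℕ → ↥N := fun n => 1 - ⟨p n, hp.mem n⟩
  have hb : ∀ n, IsEffect (b n) := fun n => ((hp.proj n).isEffect (hp.mem n)).one_sub
  have hval : ∀ f, IsStateOn N f → ∀ n, f (b n) = 1 ↔ f ⟨p n, hp.mem n⟩ = 0 := fun f hf n => by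
    simp only [b, map_sub, hf.2, sub_eq_self]
  obtain ⟨c, hc, hcb⟩ := exists_effect_forall_eq_one b hb
  refine ⟨?_, c, hc, Set.ext fun f => ⟨fun h => ⟨h.1, (hcb f h.1).2 fun n =>
    (hval f h.1 n).2 (h.2 n)⟩, fun h => ⟨h.1, fun n => (hval f h.1 n).1 ((hcb f h.1).1 h.2 n)⟩⟩⟩
  obtain ⟨f, hf, hfb⟩ := exists_isPureStateOn_forall_mem (K := fun n => stateFace N (b n)) b hb
    (fun _ => rfl) (fun s => by
    obtain ⟨m, hm⟩ := s.exists_nat_subset_range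
    obtain ⟨ζ, hζ⟩ : ∃ ζ, p (m + 1) ζ ≠ 0 := by
      by_contra! h
      exact hp0 m (ContinuousLinearMap.ext h)
    let ξ : H := ((‖p (m + 1) ζ‖⁻¹ : ℝ) : ℂ) • p (m + 1) ζ
    have hξ : ‖ξ‖ = 1 := by
      simp [ξ, norm_smul, hζ]
    have hst := isStateOn_vectorFunctional N hξ
    refine ⟨_, hst, fun i hi => ⟨hst, (hval _ hst i).2 ?_⟩⟩
    have hne : i ≠ m + 1 := by
      have := Finset.mem_range.1 (hm hi)
      omega
    have hz : p i ξ = 0 := by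
      have := DFunLike.congr_fun (hp.orth i (m + 1) hne) ζ
      change p i (p (m + 1) ζ) = 0 at this
      simp only [ξ, map_smul, this, smul_zero]
    rw [vectorFunctional_apply]
    change ⟪ξ, p i ξ⟫_ℂ = 0
    rw [hz, inner_zero_right])
  exact ⟨f, hf.1, fun n => (hval f hf.1 n).1 (hfb n).2⟩

/-- Assuming the continuum hypothesis, every infinite-dimensional factor acting on a
separable Hilbert space admits `2 ^ ℵ₁` distinct classically normal, singular pure
states. -/
theorem card_classically_normal_singular_pure_states
    (CH : (2 : Cardinal.{0}) ^ Cardinal.aleph0 = Cardinal.aleph 1)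
    {H : Type} [NormedAddCommGroup H] [InnerProductSpace ℂ H] [CompleteSpace H]
    [TopologicalSpace.SeparableSpace H]
    (N : VonNeumannAlgebra H) (hfac : IsFactor N) (hinf : ¬ FiniteDimensional ℂ ↥N) :
    ∃ S : Set (↥N →ₗ[ℂ] ℂ),
      Cardinal.mk ↥S = 2 ^ Cardinal.aleph 1 ∧
      ∀ f ∈ S, IsPureStateOn N f ∧ IsSingularOn N f ∧ IsClassicallyNormalOn N f := by
  obtain ⟨p, hp, hp0⟩ := exists_isPartition hinf
  have hK₀ := hp.isStateFace hp0
  set K₀ : Set (↥N →ₗ[ℂ] ℂ) := {f | IsStateOn N f ∧ ∀ n, f ⟨p n, hp.mem n⟩ = 0}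
  let P := {K : Set (↥N →ₗ[ℂ] ℂ) // IsStateFace N K ∧ K ⊆ K₀}
  let Q := {q : ℕ → H →L[ℂ] H // IsPartition N q}
  let ι := (Cardinal.aleph.{0} 1).ord.ToType
  have hι : Cardinal.mk ι = Cardinal.aleph 1 := Cardinal.mk_ord_toType _
  have hQ : Cardinal.mk Q ≤ Cardinal.mk ι := by
    rw [hι, ← CH]
    exact (Cardinal.mk_subtype_le _).trans mk_seq_continuousLinearMap_le
  obtain ⟨u⟩ := Cardinal.le_def _ _ |>.1 hQ
  have : Nonempty Q := ⟨⟨p, hp⟩⟩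
  obtain ⟨task, htask⟩ : ∃ task : ι → Q, Function.Surjective task :=
    ⟨_, Function.invFun_surjective u.injective⟩
  have : Nonempty ι := ⟨u ⟨p, hp⟩⟩
  have hcount : ∀ i : ι, (Set.Iio i).Countable := fun i => by
    rw [← Cardinal.le_aleph0_iff_set_countable, ← Order.lt_succ_iff, Cardinal.succ_aleph0]
    exact (Cardinal.mk_Iio_lt i (by rw [hι, Ordinal.type_toType])).trans_eq hι
  let D : ι → Set P := fun i => {K | ∀ f ∈ K.1,
    (∃ n, f ⟨(task i).1 n, (task i).2.mem n⟩ ≠ 0) ∨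
      ∃ S, f ⟨subsetSup (task i).1 S, (task i).2.subsetSup_mem S⟩ = 1 / 2}
  obtain ⟨F, hmono, hFD, hsep⟩ := exists_branching_family (P := P) hcount (fun s hs hchain => by
      rcases s.eq_empty_or_nonempty with rfl | hne
      · exact ⟨⟨K₀, hK₀, subset_rfl⟩, by simp⟩
      obtain ⟨g, rfl⟩ := hs.exists_eq_range hne
      obtain ⟨f, hf, hfg⟩ := exists_isPureStateOn_forall_mem_of_directed
        (K := fun k => (g k).1) (fun k => (g k).2.1) (fun i j => by
          rcases hchain.total ⟨i, rfl⟩ ⟨j, rfl⟩ with h | h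
          · exact ⟨i, subset_rfl, h⟩
          · exact ⟨j, h, subset_rfl⟩)
      refine ⟨⟨⋂ k, (g k).1, isStateFace_iInter (fun k => (g k).2.1) hfg,
        (Set.iInter_subset _ 0).trans (g 0).2.2⟩, ?_⟩
      rintro _ ⟨k, rfl⟩
      exact Set.iInter_subset (fun k => (g k).1) k)
    D (fun i K => by
      obtain ⟨K, ⟨⟨f, hf⟩, a, ha, rfl⟩, hK⟩ := K
      obtain ⟨b, hb, ⟨g, hg⟩, h⟩ := (task i).2.exists_refinement hfac ha ⟨f, hf⟩
      have hba : stateFace N b ⊆ stateFace N a := fun g hg => ⟨hg.1, (h g hg.1 hg.2).1⟩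
      exact ⟨⟨stateFace N b, ⟨⟨g, hg⟩, b, hb, rfl⟩, hba.trans hK⟩,
        fun g hg => (h g hg.1 hg.2).2, hba⟩)
    (fun K L => Disjoint K.1 L.1) (fun K => by
      obtain ⟨K, ⟨⟨f, hf⟩, a, ha, rfl⟩, hK⟩ := K
      obtain ⟨b, c, hb, hc, ⟨g, hg⟩, ⟨g', hg'⟩, h, h'⟩ :=
        hp.exists_incompatible hf.1 ha hf.2 (hK hf).2
      have hba : stateFace N b ⊆ stateFace N a := fun g hg => ⟨hg.1, (h g hg.1 hg.2).1⟩
      have hca : stateFace N c ⊆ stateFace N a := fun g hg => ⟨hg.1, h' g hg.1 hg.2⟩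
      exact ⟨⟨stateFace N b, ⟨⟨g, hg⟩, b, hb, rfl⟩, hba.trans hK⟩,
        ⟨stateFace N c, ⟨⟨g', hg'⟩, c, hc, rfl⟩, hca.trans hK⟩, hba, hca,
        Set.disjoint_left.2 fun k hk hk' => (h k hk.1 hk.2).2 hk'.2⟩)
  have hpure : ∀ σ, ∃ f, IsPureStateOn N f ∧ ∀ i, f ∈ (F σ i).1 := fun σ =>
    exists_isPureStateOn_forall_mem_of_directed (fun i => (F σ i).2.1)
      (fun i j => ⟨max i j, hmono σ _ _ (le_max_left i j), hmono σ _ _ (le_max_right i j)⟩)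
  choose state hstate hmem using hpure
  have hinj : Function.Injective state := fun σ τ h => by
    by_contra hne
    obtain ⟨i, hi | hi⟩ := hsep σ τ hne
    · exact Set.disjoint_left.1 hi (hmem σ i) (h ▸ hmem τ i)
    · exact Set.disjoint_left.1 hi (hmem τ i) (h ▸ hmem σ i)
  refine ⟨Set.range state, ?_, ?_⟩
  · rw [Cardinal.mk_range_eq _ hinj, ← Cardinal.power_def, hι, Cardinal.mk_bool]
  · rintro _ ⟨σ, rfl⟩
    obtain ⟨i₀⟩ := ‹Nonempty ι›
    refine ⟨hstate σ, hp.isSingularOn (hstate σ) ((F σ i₀).2.2 (hmem σ i₀)).2,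
      (hstate σ).1.isClassicallyNormalOn fun q hq => ?_⟩
    obtain ⟨i, hi⟩ := htask ⟨q, hq⟩
    obtain ⟨K, hK, hle⟩ := hFD σ i
    have h := hK _ (hle (hmem σ i))
    simp only [hi] at h
    exact h
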